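/- Maximum-principle comparison: Let d ≥ 1, let a < b be reals, and let v : [a,b] × ℝ^d → ℝ be a bounded continuous function which on (a,b) × ℝ^d is C^1 in the time variable and C^2 in the space variable, and which satisfies ∂_t v - Δv - v = -G v + R on (a,b) × ℝ^d, where G, R : (a,b) × ℝ^d → ℝ are measurable, G is non-negative, and R is bounded. Then for all (t,x) ∈ [a,b] × ℝ^d one has |v(t,x)| ≤ e^{t-a} ∫_{ℝ^d} p_{t-a}(x-y) |v(a,y)| dy + ∫_a^t e^{t-s} ∫_{ℝ^d} p_{t-s}(x-y) |R(s,y)| dy ds. -/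

import Mathlib

open Real Filter MeasureTheory

/-- The heat kernel `p_t(x) = (4πt)^{-d/2} exp(-|x|²/(4t))` on `ℝ^d`. -/
noncomputable def heatKernel (d : ℕ) (t : ℝ) (x : EuclideanSpace ℝ (Fin d)) : ℝ :=
  (4 * Real.pi * t) ^ (-(d : ℝ) / 2) * Real.exp (-‖x‖ ^ 2 / (4 * t))

/-- The Laplacian of `f : ℝ^d → ℝ`: the sum of the second partial derivatives in the
`d` coordinate directions. -/
noncomputable def laplacian {d : ℕ} (f : EuclideanSpace ℝ (Fin d) → ℝ)
    (x : EuclideanSpace ℝ (Fin d)) : ℝ :=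
  ∑ i : Fin d,
    fderiv ℝ (fun y => fderiv ℝ f y (EuclideanSpace.single i 1)) x (EuclideanSpace.single i 1)

/-- The heat semigroup `P_t f (x) = ∫ p_t(x-y) f(y) dy` for `t > 0`, with `P_0 f = f`. -/
noncomputable def heatOp (d : ℕ) (t : ℝ) (f : EuclideanSpace ℝ (Fin d) → ℝ)
    (x : EuclideanSpace ℝ (Fin d)) : ℝ :=
  if t ≤ 0 then f x else ∫ y, heatKernel d t (x - y) * f y

open scoped ENNReal Topology

lemma heatKernel_nonneg (d : ℕ) {t : ℝ} (ht : 0 < t) (x : EuclideanSpace ℝ (Fin d)) :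
    0 ≤ heatKernel d t x := by
  unfold heatKernel; positivity

lemma heatKernel_neg (d : ℕ) (t : ℝ) (x : EuclideanSpace ℝ (Fin d)) :
    heatKernel d t (-x) = heatKernel d t x := by
  simp [heatKernel]

lemma continuous_heatKernel (d : ℕ) (t : ℝ) : Continuous (heatKernel d t) := by
  unfold heatKernel; fun_prop

lemma integrable_exp_neg_mul_norm_sq (d : ℕ) {b : ℝ} (hb : 0 < b) :
    Integrable (fun x : EuclideanSpace ℝ (Fin d) => Real.exp (-b * ‖x‖ ^ 2)) := by
  have h := GaussianFourier.integral_rexp_neg_mul_sq_norm (V := EuclideanSpace ℝ (Fin d)) hb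
  by_contra hn
  rw [integral_undef hn] at h
  have : 0 < (Real.pi / b) ^ ((Module.finrank ℝ (EuclideanSpace ℝ (Fin d)) : ℝ) / 2) := by
    positivity
  linarith

lemma heatKernel_eq (d : ℕ) (t : ℝ) (x : EuclideanSpace ℝ (Fin d)) :
    heatKernel d t x
      = (4 * Real.pi * t) ^ (-(d : ℝ) / 2) * Real.exp (-(1 / (4 * t)) * ‖x‖ ^ 2) := by
  unfold heatKernel
  congr 2
  ring

lemma integrable_heatKernel (d : ℕ) {t : ℝ} (ht : 0 < t) : Integrable (heatKernel d t) := by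
  rw [funext (heatKernel_eq d t)]
  exact (integrable_exp_neg_mul_norm_sq d (by positivity)).const_mul _

lemma integral_heatKernel (d : ℕ) {t : ℝ} (ht : 0 < t) : ∫ x, heatKernel d t x = 1 := by
  rw [funext (heatKernel_eq d t), integral_const_mul,
    GaussianFourier.integral_rexp_neg_mul_sq_norm (by positivity), finrank_euclideanSpace_fin,
    show Real.pi / (1 / (4 * t)) = 4 * Real.pi * t by field_simp, ← Real.rpow_add (by positivity)]
  rw [show -(d : ℝ) / 2 + d / 2 = 0 by ring, Real.rpow_zero]

lemma integrable_heatKernel_sub (d : ℕ) {t : ℝ} (ht : 0 < t) (x : EuclideanSpace ℝ (Fin d)) :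
    Integrable (fun y => heatKernel d t (x - y)) :=
  (integrable_heatKernel d ht).comp_sub_left x

lemma integral_heatKernel_sub (d : ℕ) {t : ℝ} (ht : 0 < t) (x : EuclideanSpace ℝ (Fin d)) :
    ∫ y, heatKernel d t (x - y) = 1 := by
  rw [integral_sub_left_eq_self (heatKernel d t) volume x, integral_heatKernel d ht]

lemma heatKernel_mul_heatKernel (d : ℕ) {s t : ℝ} (hs : 0 < s) (ht : 0 < t)
    (h y : EuclideanSpace ℝ (Fin d)) :
    heatKernel d t y * heatKernel d s (h - y)
      = heatKernel d (t + s) h * heatKernel d (s * t / (t + s)) (y - (t / (t + s)) • h) := by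
  unfold heatKernel
  rw [mul_mul_mul_comm ((4 * Real.pi * t) ^ _), mul_mul_mul_comm ((4 * Real.pi * (t + s)) ^ _),
    ← Real.mul_rpow (by positivity) (by positivity),
    ← Real.mul_rpow (by positivity) (by positivity), ← Real.exp_add, ← Real.exp_add]
  congr 2
  · field_simp
  · rw [norm_sub_sq_real, norm_sub_sq_real, norm_smul, real_inner_smul_right, Real.norm_eq_abs,
      mul_pow, sq_abs, real_inner_comm]
    field_simp
    ring

lemma integral_heatKernel_mul_heatKernel (d : ℕ) {s t : ℝ} (hs : 0 < s) (ht : 0 < t)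
    (x z : EuclideanSpace ℝ (Fin d)) :
    ∫ y, heatKernel d t (x - y) * heatKernel d s (y - z) = heatKernel d (t + s) (x - z) := by
  have h1 := integral_sub_left_eq_self
    (fun y => heatKernel d t y * heatKernel d s ((x - z) - y)) volume x
  rw [show (fun y => heatKernel d t (x - y) * heatKernel d s (x - z - (x - y)))
    = fun y => heatKernel d t (x - y) * heatKernel d s (y - z) by
      ext y; congr 2; abel] at h1
  rw [h1]
  simp_rw [heatKernel_mul_heatKernel d hs ht]
  rw [integral_const_mul, integral_sub_right_eq_self (heatKernel d (s * t / (t + s))),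
    integral_heatKernel d (by positivity), mul_one]

/-- The law of the heat kernel at time one. -/
noncomputable def heatMeasure (d : ℕ) : Measure (EuclideanSpace ℝ (Fin d)) :=
  volume.withDensity (fun z => ENNReal.ofReal (heatKernel d 1 z))

lemma integral_heatMeasure (d : ℕ) (f : EuclideanSpace ℝ (Fin d) → ℝ) :
    ∫ z, f z ∂heatMeasure d = ∫ z, heatKernel d 1 z * f z := by
  unfold heatMeasure
  rw [integral_withDensity_eq_integral_toReal_smul (by have := continuous_heatKernel d 1; fun_prop)
    (by simp)]
  simp [ENNReal.toReal_ofReal (heatKernel_nonneg d one_pos _)]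

lemma integrable_heatMeasure_iff (d : ℕ) (f : EuclideanSpace ℝ (Fin d) → ℝ) :
    Integrable f (heatMeasure d) ↔ Integrable (fun z => heatKernel d 1 z * f z) := by
  unfold heatMeasure
  rw [integrable_withDensity_iff_integrable_smul' (by have := continuous_heatKernel d 1; fun_prop)
    (by simp)]
  simp [ENNReal.toReal_ofReal (heatKernel_nonneg d one_pos _)]

instance (d : ℕ) : IsProbabilityMeasure (heatMeasure d) := by
  constructor
  unfold heatMeasure
  rw [withDensity_apply _ MeasurableSet.univ, Measure.restrict_univ,
    ← ofReal_integral_eq_lintegral_ofReal (integrable_heatKernel d one_pos)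
      (Eventually.of_forall (heatKernel_nonneg d one_pos)), integral_heatKernel d one_pos,
    ENNReal.ofReal_one]

lemma integral_heatMeasure_comp_neg (d : ℕ) (f : EuclideanSpace ℝ (Fin d) → ℝ) :
    ∫ z, f (-z) ∂heatMeasure d = ∫ z, f z ∂heatMeasure d := by
  rw [integral_heatMeasure, integral_heatMeasure,
    ← integral_neg_eq_self (fun z => heatKernel d 1 z * f z)]
  simp [heatKernel_neg]

lemma heatKernel_sqrt_smul (d : ℕ) {t : ℝ} (ht : 0 < t) (z : EuclideanSpace ℝ (Fin d)) :
    heatKernel d t (√t • z) = ((√t) ^ d)⁻¹ * heatKernel d 1 z := by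
  unfold heatKernel
  rw [norm_smul, mul_pow, Real.norm_eq_abs, sq_abs, Real.sq_sqrt ht.le,
    Real.mul_rpow (by positivity) ht.le, mul_one, mul_comm _ (t ^ _), mul_assoc]
  congr 1
  · rw [Real.sqrt_eq_rpow, ← Real.rpow_natCast, ← Real.rpow_mul ht.le, ← Real.rpow_neg ht.le]
    congr 1
    ring
  · congr 2
    field_simp

/-- The heat semigroup is the average over Gaussian increments. -/
lemma heatOp_eq_integral (d : ℕ) (t : ℝ) (f : EuclideanSpace ℝ (Fin d) → ℝ)
    (x : EuclideanSpace ℝ (Fin d)) :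
    heatOp d t f x = ∫ z, f (x + √t • z) ∂heatMeasure d := by
  unfold heatOp
  split_ifs with ht
  · simp [Real.sqrt_eq_zero_of_nonpos ht]
  · push Not at ht
    rw [integral_heatMeasure]
    have h1 := Measure.integral_comp_smul volume
      (fun y => heatKernel d t y * f (x + y)) (√t)
    rw [finrank_euclideanSpace_fin, smul_eq_mul, abs_of_nonneg (by positivity)] at h1
    simp_rw [heatKernel_sqrt_smul d ht, mul_assoc, integral_const_mul] at h1
    rw [mul_right_inj' (by positivity)] at h1
    rw [h1, ← integral_sub_right_eq_self (fun y => heatKernel d t y * f (x + y)) x]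
    refine integral_congr_ae (Eventually.of_forall fun y => ?_)
    simp only [add_sub_cancel]
    rw [← heatKernel_neg, neg_sub]

lemma integrable_heatKernel_mul (d : ℕ) {t : ℝ} (ht : 0 < t) {f : EuclideanSpace ℝ (Fin d) → ℝ}
    (hf : AEStronglyMeasurable f) {M : ℝ} (hM : ∀ x, |f x| ≤ M) (x : EuclideanSpace ℝ (Fin d)) :
    Integrable (fun y => heatKernel d t (x - y) * f y) :=
  (integrable_heatKernel_sub d ht x).mul_bdd hf (Eventually.of_forall hM)

lemma abs_heatOp_le (d : ℕ) (t : ℝ) {f : EuclideanSpace ℝ (Fin d) → ℝ} {M : ℝ}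
    (hM : ∀ x, |f x| ≤ M) (x : EuclideanSpace ℝ (Fin d)) : |heatOp d t f x| ≤ M := by
  rw [heatOp_eq_integral]
  simpa using norm_integral_le_of_norm_le_const (μ := heatMeasure d)
    (f := fun z => f (x + √t • z)) (Eventually.of_forall fun z => hM _)

/-- The semigroup property of the heat flow. -/
lemma heatOp_add (d : ℕ) {s t : ℝ} (hs : 0 < s) (ht : 0 < t)
    {f : EuclideanSpace ℝ (Fin d) → ℝ} (hf : Continuous f) {M : ℝ} (hM : ∀ x, |f x| ≤ M)
    (x : EuclideanSpace ℝ (Fin d)) :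
    heatOp d (t + s) f x = heatOp d t (heatOp d s f) x := by
  simp only [heatOp, not_le.2 hs, not_le.2 ht, not_le.2 (add_pos ht hs), if_false]
  simp_rw [← integral_heatKernel_mul_heatKernel d hs ht, ← integral_const_mul,
    ← integral_mul_const]
  rw [integral_integral_swap]
  · simp only [mul_assoc]
  · have hc1 := continuous_heatKernel d t
    have hc2 := continuous_heatKernel d s
    refine (integrable_prod_iff' ?_).2 ⟨?_, ?_⟩
    · exact Continuous.aestronglyMeasurable (by fun_prop)
    · refine Eventually.of_forall fun y => ?_
      change Integrable fun z => heatKernel d t (x - y) * heatKernel d s (y - z) * f z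
      simp only [mul_assoc]
      exact (integrable_heatKernel_mul d hs hf.aestronglyMeasurable hM y).const_mul _
    · have : ∀ y, ∫ z, ‖heatKernel d t (x - y) * heatKernel d s (y - z) * f z‖
          = heatKernel d t (x - y) * heatOp d s (fun z => |f z|) y := by
        intro y
        simp only [heatOp, not_le.2 hs, if_false, ← integral_const_mul]
        congr with z
        rw [norm_mul, norm_mul, Real.norm_of_nonneg (heatKernel_nonneg d ht _),
          Real.norm_of_nonneg (heatKernel_nonneg d hs _), Real.norm_eq_abs, mul_assoc]
      change Integrable fun y => ∫ z, ‖heatKernel d t (x - y) * heatKernel d s (y - z) * f z‖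
      simp only [this]
      refine integrable_heatKernel_mul d ht ?_ (M := M) ?_ x
      · rw [funext (heatOp_eq_integral d s _)]
        apply Continuous.aestronglyMeasurable
        refine continuous_of_dominated (bound := fun _ => M) ?_ ?_ (integrable_const _) ?_
        · intro y; exact Continuous.aestronglyMeasurable (by fun_prop)
        · intro y; exact Eventually.of_forall fun z => by simpa using hM _
        · exact Eventually.of_forall fun z => by fun_prop
      · exact fun y => abs_heatOp_le d s (fun z => by simpa using hM z) y

lemma integrable_norm_sq_heatMeasure (d : ℕ) :
    Integrable (fun z => ‖z‖ ^ 2) (heatMeasure d) := by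
  rw [integrable_heatMeasure_iff]
  have hc := continuous_heatKernel d 1
  refine ((integrable_exp_neg_mul_norm_sq d (b := 1 / 8) (by norm_num)).const_mul
    ((4 * Real.pi * 1) ^ (-(d : ℝ) / 2) * 8)).mono'
    (Continuous.aestronglyMeasurable (by fun_prop)) (Eventually.of_forall fun z => ?_)
  have h0 : 0 ≤ heatKernel d 1 z * ‖z‖ ^ 2 :=
    mul_nonneg (heatKernel_nonneg d one_pos z) (sq_nonneg _)
  rw [Real.norm_of_nonneg h0, heatKernel_eq, mul_assoc (_ ^ _), mul_assoc (_ ^ _)]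
  refine mul_le_mul_of_nonneg_left ?_ (by positivity)
  have h1 : ‖z‖ ^ 2 / 8 ≤ Real.exp (1 / 8 * ‖z‖ ^ 2) := by
    have := Real.add_one_le_exp (1 / 8 * ‖z‖ ^ 2)
    linarith
  have h2 : Real.exp (-(1 / 8) * ‖z‖ ^ 2)
      = Real.exp (-(1 / (4 * 1)) * ‖z‖ ^ 2) * Real.exp (1 / 8 * ‖z‖ ^ 2) := by
    rw [← Real.exp_add]; congr 1; ring
  rw [h2]
  nlinarith [Real.exp_pos (-(1 / (4 * 1)) * ‖z‖ ^ 2)]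

lemma integrable_coord_mul_coord (d : ℕ) (i j : Fin d) :
    Integrable (fun z => z i * z j) (heatMeasure d) := by
  refine (integrable_norm_sq_heatMeasure d).mono' (Continuous.aestronglyMeasurable (by fun_prop))
    (Eventually.of_forall fun z => ?_)
  rw [norm_mul, sq]
  exact mul_le_mul (PiLp.norm_apply_le z i) (PiLp.norm_apply_le z j) (norm_nonneg _) (norm_nonneg _)

lemma hasFDerivAt_heatKernel_one (d : ℕ) (z : EuclideanSpace ℝ (Fin d)) :
    HasFDerivAt (heatKernel d 1) ((-(heatKernel d 1 z) / 2) • innerSL ℝ z) z := by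
  have h1 : HasFDerivAt (fun z : EuclideanSpace ℝ (Fin d) => ‖z‖ ^ 2) (2 • innerSL ℝ z) z :=
    (hasStrictFDerivAt_norm_sq z).hasFDerivAt
  have h2 := ((h1.const_mul (-(1 / (4 * 1 : ℝ)))).exp).const_mul
    ((4 * Real.pi * 1) ^ (-(d : ℝ) / 2))
  rw [funext (heatKernel_eq d 1)]
  refine h2.congr_fderiv ?_
  ext v
  simp
  ring

lemma integral_coord_mul_coord (d : ℕ) (i j : Fin d) :
    ∫ z, z i * z j ∂heatMeasure d = if i = j then 2 else 0 := by
  have hd : ∀ z : EuclideanSpace ℝ (Fin d), fderiv ℝ (heatKernel d 1) z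
      (EuclideanSpace.single i 1) = -(1 / 2) * (heatKernel d 1 z * z i) := by
    intro z
    rw [(hasFDerivAt_heatKernel_one d z).fderiv]
    simp [EuclideanSpace.inner_single_right]
    ring
  have hg : ∀ z : EuclideanSpace ℝ (Fin d), fderiv ℝ (fun z : EuclideanSpace ℝ (Fin d) => z j) z
      (EuclideanSpace.single i 1) = if i = j then 1 else 0 := by
    intro z
    have : HasFDerivAt (fun z : EuclideanSpace ℝ (Fin d) => z j)
      (EuclideanSpace.proj j : EuclideanSpace ℝ (Fin d) →L[ℝ] ℝ) z :=
      (EuclideanSpace.proj j : EuclideanSpace ℝ (Fin d) →L[ℝ] ℝ).hasFDerivAt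
    rw [this.fderiv]
    simp [eq_comm]
  have hc : Continuous (heatKernel d 1) := continuous_heatKernel d 1
  have hij := (integrable_heatMeasure_iff d _).1 (integrable_coord_mul_coord d i j)
  have key := integral_mul_fderiv_eq_neg_fderiv_mul_of_integrable (μ := volume)
    (f := heatKernel d 1) (g := fun z : EuclideanSpace ℝ (Fin d) => z j)
    (v := EuclideanSpace.single i 1) ?_ ?_ ?_
    (fun z _ => (hasFDerivAt_heatKernel_one d z).differentiableAt)
    (fun z _ => by fun_prop)
  · simp_rw [hg, hd] at key
    rw [integral_mul_const, integral_heatKernel d one_pos] at key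
    rw [integral_heatMeasure]
    have : ∫ z : EuclideanSpace ℝ (Fin d), -(1 / 2) * (heatKernel d 1 z * z i) * z j
        = -(1 / 2) * ∫ z : EuclideanSpace ℝ (Fin d), heatKernel d 1 z * (z i * z j) := by
      rw [← integral_const_mul]; congr with z; ring
    rw [this] at key
    split_ifs at key ⊢ <;> linarith
  · simp_rw [hd]
    refine (hij.const_mul (-(1 / 2))).congr (Eventually.of_forall fun z => ?_)
    simp only; ring
  · simp_rw [hg]
    exact (integrable_heatKernel d one_pos).mul_const _
  · rw [← integrable_heatMeasure_iff]
    refine ((integrable_norm_sq_heatMeasure d).add (integrable_const 1)).mono'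
      (Continuous.aestronglyMeasurable (by fun_prop)) (Eventually.of_forall fun z => ?_)
    have := PiLp.norm_apply_le z j
    simp only [Pi.add_apply]
    nlinarith [sq_nonneg (‖z‖ - 1)]

lemma integral_quadratic_heatMeasure (d : ℕ)
    (B : EuclideanSpace ℝ (Fin d) →L[ℝ] EuclideanSpace ℝ (Fin d) →L[ℝ] ℝ) :
    ∫ z, B z z ∂heatMeasure d
      = 2 * ∑ i, B (EuclideanSpace.single i 1) (EuclideanSpace.single i 1) := by
  have hB : ∀ z : EuclideanSpace ℝ (Fin d), B z z
      = ∑ i, ∑ j, (z i * z j) * B (EuclideanSpace.single i 1) (EuclideanSpace.single j 1) := by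
    intro z
    have hz : z = ∑ i, z i • EuclideanSpace.single i (1 : ℝ) := by
      have := (EuclideanSpace.basisFun (Fin d) ℝ).sum_repr z
      simpa using this.symm
    conv_lhs => rw [hz]
    simp only [map_sum, sum_apply, map_smul, smul_apply,
      smul_eq_mul, Finset.mul_sum]
    rw [Finset.sum_comm]
    refine Finset.sum_congr rfl fun i _ => Finset.sum_congr rfl fun j _ => ?_
    ring
  simp_rw [hB]
  rw [integral_finsetSum _ fun i _ => integrable_finsetSum _ fun j _ =>
    (integrable_coord_mul_coord d i j).mul_const _, Finset.mul_sum]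
  refine Finset.sum_congr rfl fun i _ => ?_
  rw [integral_finsetSum _ fun j _ => (integrable_coord_mul_coord d i j).mul_const _]
  simp_rw [integral_mul_const, integral_coord_mul_coord]
  simp

/-- The symmetric second difference of a `C²` function is its Hessian, up to second order. -/
lemma second_difference_estimate {E : Type*} [NormedAddCommGroup E] [NormedSpace ℝ E] {w : E → ℝ}
    (hw : ContDiff ℝ 2 w) (y : E) {c : ℝ} (hc : 0 < c) :
    ∃ δ > 0, ∀ h, ‖h‖ < δ →
      |w (y + h) + w (y - h) - 2 * w y - fderiv ℝ (fderiv ℝ w) y h h| ≤ c * ‖h‖ ^ 2 := by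
  have hw1 : ContDiff ℝ 1 (fderiv ℝ w) := hw.fderiv_right (by norm_num)
  have hd : HasFDerivAt (fderiv ℝ w) (fderiv ℝ (fderiv ℝ w) y) y :=
    (hw1.differentiable (by norm_num) y).hasFDerivAt
  set B := fderiv ℝ (fderiv ℝ w) y
  have hlo := (hasFDerivAt_iff_isLittleO_nhds_zero.1 hd).def (half_pos hc)
  obtain ⟨δ, hδ, hball⟩ := Metric.eventually_nhds_iff.1 hlo
  refine ⟨δ, hδ, fun h hh => ?_⟩
  have hderiv : ∀ r ∈ Set.Icc (0 : ℝ) 1, HasDerivWithinAt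
      (fun r : ℝ => w (y + r • h) + w (y - r • h) - 2 * w y - r ^ 2 * B h h)
      (fderiv ℝ w (y + r • h) h - fderiv ℝ w (y - r • h) h - 2 * r * B h h)
      (Set.Icc 0 1) r := by
    intro r _
    have hl1 : HasDerivAt (fun r : ℝ => y + r • h) h r := by
      simpa using ((hasDerivAt_id r).smul_const h).const_add y
    have hl2 : HasDerivAt (fun r : ℝ => y - r • h) (-h) r := by
      simpa using ((hasDerivAt_id r).smul_const h).const_sub y
    have hwd : ∀ x, HasFDerivAt w (fderiv ℝ w x) x := fun x =>
      (hw.differentiable (by norm_num) x).hasFDerivAt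
    have h1 := (hwd (y + r • h)).comp_hasDerivAt r hl1
    have h2 := (hwd (y - r • h)).comp_hasDerivAt r hl2
    have h3 := ((h1.add h2).sub_const (2 * w y)).sub (((hasDerivAt_id r).pow 2).mul_const (B h h))
    refine (h3.congr_deriv ?_).hasDerivWithinAt
    simp
    ring
  have key := norm_image_sub_le_of_norm_deriv_le_segment_01' hderiv (C := c * ‖h‖ ^ 2) ?_
  · simpa [← two_mul] using key
  · intro r hr
    have hrh : ‖r • h‖ ≤ ‖h‖ := by
      rw [norm_smul, Real.norm_of_nonneg hr.1]
      exact mul_le_of_le_one_left (norm_nonneg _) hr.2.le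
    have e1 := hball (y := r • h) (by simpa using hrh.trans_lt hh)
    have e2 := hball (y := -(r • h)) (by simpa using hrh.trans_lt hh)
    rw [norm_neg] at e2
    have e3 : fderiv ℝ w (y + r • h) h - fderiv ℝ w (y - r • h) h - 2 * r * B h h
        = (fderiv ℝ w (y + r • h) - fderiv ℝ w y - B (r • h)) h
          - (fderiv ℝ w (y + -(r • h)) - fderiv ℝ w y - B (-(r • h))) h := by
      simp [sub_eq_add_neg]
      ring
    rw [e3]
    refine (norm_sub_le _ _).trans ?_
    have f1 := ContinuousLinearMap.le_of_opNorm_le _ e1 h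
    have f2 := ContinuousLinearMap.le_of_opNorm_le _ e2 h
    have f3 : ‖r • h‖ * ‖h‖ ≤ ‖h‖ * ‖h‖ := by gcongr
    nlinarith

lemma second_difference_bound {E : Type*} [NormedAddCommGroup E] [NormedSpace ℝ E] {w : E → ℝ}
    (hw : ContDiff ℝ 2 w) {M : ℝ} (hM : ∀ x, |w x| ≤ M) (y : E) :
    ∃ C, ∀ h, |w (y + h) + w (y - h) - 2 * w y| ≤ C * ‖h‖ ^ 2 := by
  obtain ⟨δ, hδ, H⟩ := second_difference_estimate hw y one_pos
  have hM0 : 0 ≤ M := (abs_nonneg _).trans (hM y)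
  refine ⟨‖fderiv ℝ (fderiv ℝ w) y‖ + 1 + 4 * M / δ ^ 2, fun h => ?_⟩
  rcases lt_or_ge ‖h‖ δ with hh | hh
  · have h1 := H h hh
    have h2 := ContinuousLinearMap.le_opNorm₂ (fderiv ℝ (fderiv ℝ w) y) h h
    rw [Real.norm_eq_abs] at h2
    have h3 : |w (y + h) + w (y - h) - 2 * w y| ≤ _ :=
      (abs_sub_abs_le_abs_sub _ _).trans h1 |> sub_le_iff_le_add.1
    have h4 : 0 ≤ 4 * M / δ ^ 2 * ‖h‖ ^ 2 := by positivity
    nlinarith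
  · have h1 : |w (y + h) + w (y - h) - 2 * w y| ≤ 4 * M := by
      have a1 := abs_le.1 (hM (y + h)); have a2 := abs_le.1 (hM (y - h)); have a3 := abs_le.1 (hM y)
      rw [abs_le]; constructor <;> linarith
    have h2 : 4 * M ≤ 4 * M / δ ^ 2 * ‖h‖ ^ 2 := by
      rw [div_mul_eq_mul_div, le_div_iff₀ (by positivity)]
      gcongr
    have h3 : 0 ≤ (‖fderiv ℝ (fderiv ℝ w) y‖ + 1) * ‖h‖ ^ 2 := by positivity
    nlinarith

lemma laplacian_eq {d : ℕ} {w : EuclideanSpace ℝ (Fin d) → ℝ} (hw : ContDiff ℝ 2 w)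
    (y : EuclideanSpace ℝ (Fin d)) :
    laplacian w y = ∑ i, fderiv ℝ (fderiv ℝ w) y (EuclideanSpace.single i 1)
      (EuclideanSpace.single i 1) := by
  have hw1 : ContDiff ℝ 1 (fderiv ℝ w) := hw.fderiv_right (by norm_num)
  unfold laplacian
  refine Finset.sum_congr rfl fun i _ => ?_
  rw [fderiv_clm_apply (hw1.differentiable (by norm_num) y) (by fun_prop)]
  simp

lemma integrable_comp_heatMeasure {d : ℕ} {w : EuclideanSpace ℝ (Fin d) → ℝ} (hw : Continuous w)
    {M : ℝ} (hM : ∀ x, |w x| ≤ M) (y : EuclideanSpace ℝ (Fin d)) (r : ℝ) :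
    Integrable (fun z => w (y + r • z)) (heatMeasure d) :=
  (integrable_const M).mono' (Continuous.aestronglyMeasurable (by fun_prop))
    (Eventually.of_forall fun z => hM _)

lemma heatOp_sub_eq_integral {d : ℕ} {w : EuclideanSpace ℝ (Fin d) → ℝ} (hw : Continuous w)
    {M : ℝ} (hM : ∀ x, |w x| ≤ M) (y : EuclideanSpace ℝ (Fin d)) (s : ℝ) :
    heatOp d s w y - w y
      = ∫ z, (w (y + √s • z) + w (y - √s • z) - 2 * w y) / 2 ∂heatMeasure d := by
  have h1 := integrable_comp_heatMeasure hw hM y (√s)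
  have h2 := integrable_comp_heatMeasure hw hM y (-√s)
  have h3 := integral_heatMeasure_comp_neg d (fun z => w (y + √s • z))
  simp only [neg_smul, smul_neg, ← sub_eq_add_neg] at h2 h3
  have h4 : Integrable (fun z => w (y + √s • z) + w (y - √s • z)) (heatMeasure d) := h1.add h2
  rw [heatOp_eq_integral, integral_div, integral_sub h4 (integrable_const _),
    integral_add h1 h2, h3]
  simp
  ring

/-- The Laplacian generates the heat semigroup on bounded `C²` functions. -/
lemma tendsto_heatOp_sub_div {d : ℕ} {w : EuclideanSpace ℝ (Fin d) → ℝ} (hw : ContDiff ℝ 2 w)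
    {M : ℝ} (hM : ∀ x, |w x| ≤ M) (y : EuclideanSpace ℝ (Fin d)) :
    Tendsto (fun s => (heatOp d s w y - w y) / s) (𝓝[>] 0) (𝓝 (laplacian w y)) := by
  have hwc := hw.continuous
  obtain ⟨C, hC⟩ := second_difference_bound hw hM y
  set B := fderiv ℝ (fderiv ℝ w) y with hB
  have hlim : laplacian w y = ∫ z, B z z / 2 ∂heatMeasure d := by
    rw [integral_div, integral_quadratic_heatMeasure, laplacian_eq hw, ← hB]
    ring
  simp_rw [hlim, heatOp_sub_eq_integral hwc hM, ← integral_div]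
  refine tendsto_integral_filter_of_dominated_convergence (fun z => C * ‖z‖ ^ 2 / 2) ?_ ?_
    (((integrable_norm_sq_heatMeasure d).const_mul C).div_const 2) ?_
  · exact Eventually.of_forall fun s => Continuous.aestronglyMeasurable (by fun_prop)
  · filter_upwards [self_mem_nhdsWithin] with s hs
    rw [Set.mem_Ioi] at hs
    refine Eventually.of_forall fun z => ?_
    have h1 := hC (√s • z)
    rw [norm_smul, mul_pow, Real.norm_eq_abs, sq_abs, Real.sq_sqrt hs.le] at h1
    rw [norm_div, norm_div, Real.norm_of_nonneg hs.le, div_le_iff₀ hs, Real.norm_two,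
      Real.norm_eq_abs]
    linarith
  · refine Eventually.of_forall fun z => ?_
    rw [Metric.tendsto_nhds]
    intro ε hε
    obtain ⟨δ, hδ, H⟩ := second_difference_estimate hw y
      (c := ε / (‖z‖ ^ 2 + 1)) (by positivity)
    have hz : Tendsto (fun s => √s • z) (𝓝[>] 0) (𝓝 0) := by
      have : Continuous fun s => √s • z := by fun_prop
      simpa using (this.tendsto 0).mono_left nhdsWithin_le_nhds
    filter_upwards [self_mem_nhdsWithin, hz.eventually (Metric.ball_mem_nhds _ hδ)] with s hs hzs
    rw [Set.mem_Ioi] at hs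
    have h1 := H (√s • z) (by simpa using hzs)
    rw [norm_smul, mul_pow, Real.norm_eq_abs, sq_abs, Real.sq_sqrt hs.le, map_smul, map_smul,
      smul_apply, smul_smul, Real.mul_self_sqrt hs.le, smul_eq_mul, ← hB] at h1
    have h2 : ε / (‖z‖ ^ 2 + 1) * (s * ‖z‖ ^ 2) < 2 * ε * s := by
      have : ε / (‖z‖ ^ 2 + 1) * ‖z‖ ^ 2 ≤ ε := by
        rw [div_mul_eq_mul_div, div_le_iff₀ (by positivity)]
        nlinarith
      nlinarith [mul_pos hε hs]
    rw [Real.dist_eq, show ∀ a : ℝ, a / 2 / s - B z z / 2 = (a - s * B z z) / (2 * s) by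
      intro a; field_simp, abs_div, abs_of_pos (by positivity : 0 < 2 * s),
      div_lt_iff₀ (by positivity)]
    linarith

/-- The quadratic sup-convolution `x ↦ sup_z (g (x + z) - c ‖z‖²)`. -/
noncomputable def supConv {E : Type*} [NormedAddCommGroup E] (c : ℝ) (g : E → ℝ) (x : E) : ℝ :=
  ⨆ z, (g (x + z) - c * ‖z‖ ^ 2)

section SupConv

variable {E : Type*} [NormedAddCommGroup E] {c M : ℝ} {g : E → ℝ}

lemma le_supConv (hc : 0 ≤ c) (hM : ∀ x, g x ≤ M) (x z : E) :
    g (x + z) - c * ‖z‖ ^ 2 ≤ supConv c g x := by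
  refine le_ciSup (f := fun z => g (x + z) - c * ‖z‖ ^ 2) ⟨M, ?_⟩ z
  rintro _ ⟨z, rfl⟩
  have : 0 ≤ c * ‖z‖ ^ 2 := by positivity
  linarith [hM (x + z)]

lemma self_le_supConv (hc : 0 ≤ c) (hM : ∀ x, g x ≤ M) (x : E) : g x ≤ supConv c g x := by
  simpa using le_supConv hc hM x 0

lemma supConv_le (hc : 0 ≤ c) (hM : ∀ x, g x ≤ M) (x : E) : supConv c g x ≤ M := by
  refine ciSup_le fun z => ?_
  have : 0 ≤ c * ‖z‖ ^ 2 := by positivity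
  linarith [hM (x + z)]

lemma abs_supConv_le (hc : 0 ≤ c) (hM : ∀ x, g x ≤ M) (h0 : ∀ x, 0 ≤ g x) (x : E) :
    |supConv c g x| ≤ M := by
  rw [abs_of_nonneg ((h0 x).trans (self_le_supConv hc hM x))]
  exact supConv_le hc hM x

variable [ProperSpace E]

lemma exists_supConv_eq (hc : 0 < c) (hg : Continuous g) (hM : ∀ x, g x ≤ M) (h0 : ∀ x, 0 ≤ g x)
    (x : E) : ∃ z, supConv c g x = g (x + z) - c * ‖z‖ ^ 2 ∧ ‖z‖ ≤ √(M / c) := by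
  have hM0 : 0 ≤ M := (h0 x).trans (hM x)
  obtain ⟨z, hz, hmax⟩ := (isCompact_closedBall (0 : E) (√(M / c))).exists_isMaxOn
    ⟨0, by simp⟩ (f := fun z => g (x + z) - c * ‖z‖ ^ 2)
    (Continuous.continuousOn (by fun_prop))
  refine ⟨z, le_antisymm (ciSup_le fun y => ?_) (le_supConv hc.le hM x z), by simpa using hz⟩
  by_cases hy : y ∈ Metric.closedBall (0 : E) (√(M / c))
  · exact hmax hy
  · have h1 : g (x + 0) - c * ‖(0 : E)‖ ^ 2 ≤ g (x + z) - c * ‖z‖ ^ 2 := hmax (by simp)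
    have h2 : M / c < ‖y‖ ^ 2 := by
      rw [mem_closedBall_zero_iff, not_le] at hy
      exact (Real.sqrt_lt' ((Real.sqrt_nonneg _).trans_lt hy)).1 hy
    rw [div_lt_iff₀' hc] at h2
    simp only [add_zero, norm_zero] at h1
    linarith [h0 x, hM (x + y)]

lemma supConv_eq_sSup (hc : 0 < c) (hg : Continuous g) (hM : ∀ x, g x ≤ M) (h0 : ∀ x, 0 ≤ g x)
    (x : E) : supConv c g x
      = sSup ((fun z => g (x + z) - c * ‖z‖ ^ 2) '' Metric.closedBall 0 (√(M / c))) := by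
  obtain ⟨z, hz, hz'⟩ := exists_supConv_eq hc hg hM h0 x
  have h : IsGreatest ((fun z => g (x + z) - c * ‖z‖ ^ 2) '' Metric.closedBall 0 (√(M / c)))
      (supConv c g x) := by
    refine ⟨⟨z, by simpa using hz', hz.symm⟩, ?_⟩
    rintro _ ⟨y, -, rfl⟩
    exact le_supConv hc.le hM x y
  exact h.csSup_eq.symm

lemma continuous_supConv {X : Type*} [TopologicalSpace X] {u : X → E → ℝ} (hc : 0 < c)
    (hu : Continuous fun p : X × E => u p.1 p.2) (hM : ∀ t x, u t x ≤ M) (h0 : ∀ t x, 0 ≤ u t x) :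
    Continuous fun p : X × E => supConv c (u p.1) p.2 := by
  have h1 : ∀ t, Continuous (u t) := fun t => hu.comp (Continuous.prodMk_right t)
  simp_rw [fun p : X × E => supConv_eq_sSup hc (h1 p.1) (hM p.1) (h0 p.1) p.2]
  refine IsCompact.continuous_sSup (f := fun (p : X × E) z => u p.1 (p.2 + z) - c * ‖z‖ ^ 2)
    (isCompact_closedBall (0 : E) (√(M / c))) ?_
  have := hu.comp (f := fun q : (X × E) × E => (q.1.1, q.1.2 + q.2)) (by fun_prop)
  exact this.sub (by fun_prop)

lemma tendsto_supConv (hg : Continuous g) (hM : ∀ x, g x ≤ M) (h0 : ∀ x, 0 ≤ g x) (x : E) :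
    Tendsto (fun c => supConv c g x) atTop (𝓝 (g x)) := by
  refine tendsto_order.2 ⟨fun l hl => ?_, fun l hl => ?_⟩
  · filter_upwards [eventually_ge_atTop 0] with c hc
    exact hl.trans_le (self_le_supConv hc hM x)
  · obtain ⟨δ, hδ, H⟩ := Metric.continuous_iff.1 hg x (l - g x) (by linarith)
    have h1 : Tendsto (fun c => √(M / c)) atTop (𝓝 0) := by
      have : Tendsto (fun c => M / c) atTop (𝓝 0) := tendsto_const_nhds.div_atTop tendsto_id
      simpa using this.sqrt
    filter_upwards [eventually_gt_atTop 0, h1.eventually_lt_const hδ] with c hc hcδ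
    obtain ⟨z, hz, hz'⟩ := exists_supConv_eq hc hg hM h0 x
    have h2 := H (x + z) (by simpa using hz'.trans_lt hcδ)
    rw [Real.dist_eq, abs_lt] at h2
    have : 0 ≤ c * ‖z‖ ^ 2 := by positivity
    linarith

end SupConv

lemma supConv_add_supConv {E : Type*} [NormedAddCommGroup E] [InnerProductSpace ℝ E]
    [ProperSpace E] {c M : ℝ} {g : E → ℝ} (hc : 0 < c) (hg : Continuous g)
    (hM : ∀ x, g x ≤ M) (h0 : ∀ x, 0 ≤ g x) (x h : E) :
    2 * supConv c g x - 2 * c * ‖h‖ ^ 2 ≤ supConv c g (x + h) + supConv c g (x - h) := by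
  obtain ⟨z, hz, -⟩ := exists_supConv_eq hc hg hM h0 x
  have h1 := le_supConv hc.le hM (x + h) (z - h)
  have h2 := le_supConv hc.le hM (x - h) (z + h)
  rw [show x + h + (z - h) = x + z by abel] at h1
  rw [show x - h + (z + h) = x + z by abel] at h2
  have h3 := parallelogram_law_with_norm ℝ z h
  nlinarith

lemma secondDiff_le_of_isMax {E : Type*} [NormedAddCommGroup E] [InnerProductSpace ℝ E]
    {c : ℝ} {w : E → ℝ} {x z : E} (hc : 0 ≤ c)
    (hz : ∀ z', w (x + z') - c * ‖z'‖ ^ 2 ≤ w (x + z) - c * ‖z‖ ^ 2) (h : E) :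
    w (x + z + h) + w (x + z - h) - 2 * w (x + z) ≤ 2 * c * ‖h‖ ^ 2 := by
  have h1 := hz (z + h)
  have h2 := hz (z - h)
  rw [← add_assoc] at h1
  rw [← add_sub_assoc] at h2
  have h3 := parallelogram_law_with_norm ℝ z h
  nlinarith

lemma eq_of_isMax {E : Type*} [NormedAddCommGroup E] [InnerProductSpace ℝ E] [CompleteSpace E]
    {c : ℝ} {w : E → ℝ} {x z : E} (hc : 0 < c) (hw : Differentiable ℝ w)
    (hz : ∀ z', w (x + z') - c * ‖z'‖ ^ 2 ≤ w (x + z) - c * ‖z‖ ^ 2) :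
    x = (x + z) - (1 / (2 * c)) • gradient w (x + z) := by
  have h1 : HasFDerivAt (fun z' => w (x + z') - c * ‖z'‖ ^ 2)
      (fderiv ℝ w (x + z) - c • (2 • innerSL ℝ z)) z := by
    refine HasFDerivAt.sub ?_ ((hasStrictFDerivAt_norm_sq z).hasFDerivAt.const_mul c)
    have := (hw (x + z)).hasFDerivAt.comp z ((hasFDerivAt_id z).const_add x)
    simpa [Function.comp_def] using this
  have h2 : IsLocalMax (fun z' => w (x + z') - c * ‖z'‖ ^ 2) z := Eventually.of_forall hz
  have h3 := h2.hasFDerivAt_eq_zero h1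
  have h4 : gradient w (x + z) = (2 * c) • z := by
    refine ext_inner_right ℝ fun y => ?_
    rw [gradient, InnerProductSpace.toDual_symm_apply]
    have := DFunLike.congr_fun h3 y
    simp at this
    rw [inner_smul_left]
    simp
    linarith
  rw [h4, smul_smul, one_div_mul_cancel (by positivity), one_smul]
  abel

lemma ofReal_integral_le_lintegral {α : Type*} [MeasurableSpace α] {μ : Measure α} {f : α → ℝ}
    (hf : Integrable f μ) : ENNReal.ofReal (∫ x, f x ∂μ) ≤ ∫⁻ x, ENNReal.ofReal (f x) ∂μ := by
  have h := ofReal_integral_eq_lintegral_ofReal hf.pos_part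
    (Eventually.of_forall fun x => le_max_right _ _)
  refine (ENNReal.ofReal_le_ofReal (integral_mono hf hf.pos_part fun x => le_max_left _ _)).trans ?_
  rw [h]
  refine lintegral_mono fun x => ?_
  rcases le_total (f x) 0 with hx | hx <;> simp [hx]

/-- A continuous function whose left difference quotients are eventually below every `r > C`
is one-sided Lipschitz. -/
lemma sub_le_of_left_slope_lt {g : ℝ → ℝ} {a T C : ℝ} (hg : Continuous g) (hC : 0 ≤ C)
    (hga : ∀ t ≤ a, g t = g a)
    (hs : ∀ t ∈ Set.Ioo a T, ∀ r > C, ∀ᶠ s in 𝓝[>] 0, (g t - g (t - s)) / s < r)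
    {t : ℝ} (ht : t ∈ Set.Ioo a T) {s : ℝ} (hs0 : 0 < s) : g t - g (t - s) ≤ C * s := by
  set t₀ := max a (t - s) with ht₀
  have hle : t₀ ≤ t := max_le ht.1.le (by linarith)
  have key := image_le_of_liminf_slope_right_le_deriv_boundary (f := fun r => -g (-r))
    (a := -t) (b := -t₀) (Continuous.continuousOn (by fun_prop))
    (B := fun r => -g t + C * (r + t)) (B' := fun _ => C) (by simp)
    (Continuous.continuousOn (by fun_prop))
    (fun r _ => by
      simpa using (((hasDerivAt_id r).add_const t).const_mul C).const_add (-g t)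
        |>.hasDerivWithinAt)
    (fun r hr q hq => by
      have hr' : -r ∈ Set.Ioo a T := by
        have := le_max_left a (t - s)
        have h1 := hr.1
        have h2 := hr.2
        have h3 := ht.2
        constructor <;> linarith
      have h1 : Tendsto (fun z => z - r) (𝓝[>] r) (𝓝[>] 0) := by
        refine tendsto_nhdsWithin_iff.2 ⟨?_, ?_⟩
        · have : Tendsto (fun z : ℝ => z - r) (𝓝 r) (𝓝 (r - r)) := by
            exact (continuous_id.sub continuous_const).tendsto r
          rw [sub_self] at this
          exact this.mono_left nhdsWithin_le_nhds
        · filter_upwards [self_mem_nhdsWithin] with z hz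
          exact sub_pos.2 (Set.mem_Ioi.1 hz)
      refine Eventually.frequently ?_
      filter_upwards [h1.eventually (hs _ hr' q hq)] with z hz
      rw [slope_def_field]
      convert hz using 2
      rw [show -r - (z - r) = -z by ring]
      ring)
    (Set.right_mem_Icc.2 (neg_le_neg hle))
  simp only [neg_neg] at key
  have h1 : g (t - s) = g t₀ := by
    rcases le_total a (t - s) with h | h
    · rw [ht₀, max_eq_right h]
    · rw [ht₀, max_eq_left h, hga _ h]
  have h2 : C * (t - t₀) ≤ C * s :=
    mul_le_mul_of_nonneg_left (by linarith [le_max_right a (t - s)]) hC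
  rw [h1]
  linarith

lemma tendsto_inv_add_one_nhdsGT :
    Tendsto (fun n : ℕ => 1 / ((n : ℝ) + 1)) atTop (𝓝[>] 0) :=
  tendsto_nhdsWithin_iff.2 ⟨tendsto_one_div_add_atTop_nhds_zero_nat,
    Eventually.of_forall fun n => by simp only [Set.mem_Ioi]; positivity⟩

lemma tendsto_left_slope {g : ℝ → ℝ} {g' x : ℝ} (hg : HasDerivAt g g' x) :
    Tendsto (fun s => (g x - g (x - s)) / s) (𝓝[>] 0) (𝓝 g') := by
  have h1 : Tendsto (fun s : ℝ => x - s) (𝓝[>] 0) (𝓝[≠] x) := by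
    refine tendsto_nhdsWithin_iff.2 ⟨?_, ?_⟩
    · have : Tendsto (fun s : ℝ => x - s) (𝓝 0) (𝓝 (x - 0)) :=
        (continuous_const.sub continuous_id).tendsto 0
      rw [sub_zero] at this
      exact this.mono_left nhdsWithin_le_nhds
    · filter_upwards [self_mem_nhdsWithin] with s hs
      have : (0 : ℝ) < s := hs
      simp [this.ne']
  refine (hg.tendsto_slope.comp h1).congr fun s => ?_
  rw [Function.comp, slope_def_field, show x - s - x = -s by ring, div_neg, ← neg_div, neg_sub]

/-- The increment of a continuous function with left difference quotients bounded above is at most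
the upper integral of the upper left derivative. -/
lemma ofReal_sub_le_lintegral_limsup {φ : ℝ → ℝ} {a T C : ℝ} (haT : a < T) (hφ : Continuous φ)
    (hC : ∀ t ∈ Set.Ioo a T, ∀ s ∈ Set.Ioc (0 : ℝ) 1, (φ t - φ (t - s)) / s ≤ C) :
    ENNReal.ofReal (φ T - φ a) ≤ ∫⁻ t in Set.Ioo a T, limsup (fun n : ℕ =>
      ENNReal.ofReal ((φ t - φ (t - 1 / ((n : ℝ) + 1))) / (1 / ((n : ℝ) + 1)))) atTop := by
  set F : ℝ → ℝ := fun x => ∫ t in a..x, φ t with hF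
  have hFd : ∀ x, HasDerivAt F (φ x) x := fun x =>
    intervalIntegral.integral_hasDerivAt_right (hφ.intervalIntegrable _ _)
      (hφ.stronglyMeasurableAtFilter _ _) hφ.continuousAt
  have hslope : ∀ x, Tendsto (fun s => (F x - F (x - s)) / s) (𝓝[>] 0) (𝓝 (φ x)) := fun x =>
    tendsto_left_slope (hFd x)
  have hint : ∀ s, ∫ t in Set.Ioo a T, (φ t - φ (t - s)) / s
      = (F T - F (T - s)) / s - (F a - F (a - s)) / s := by
    intro s
    have hi : ∀ x y, IntervalIntegrable φ volume x y := fun x y => hφ.intervalIntegrable _ _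
    rw [← integral_Ioc_eq_integral_Ioo, ← intervalIntegral.integral_of_le haT.le,
      intervalIntegral.integral_div, intervalIntegral.integral_sub (hi _ _)
      (Continuous.intervalIntegrable (by fun_prop) _ _),
      intervalIntegral.integral_comp_sub_right φ s, ← sub_div]
    congr 1
    have h1 := intervalIntegral.integral_interval_sub_left (hi a (T - s)) (hi a (a - s))
    simp only [hF, intervalIntegral.integral_same] at h1 ⊢
    linarith
  have hlim : Tendsto (fun n : ℕ => ENNReal.ofReal (∫ t in Set.Ioo a T,
      (φ t - φ (t - 1 / ((n : ℝ) + 1))) / (1 / ((n : ℝ) + 1)))) atTop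
      (𝓝 (ENNReal.ofReal (φ T - φ a))) := by
    simp_rw [hint]
    exact (ENNReal.continuous_ofReal.tendsto _).comp
      (((hslope T).sub (hslope a)).comp tendsto_inv_add_one_nhdsGT)
  rw [← hlim.limsup_eq]
  refine (limsup_le_limsup (Eventually.of_forall fun n => ofReal_integral_le_lintegral ?_)).trans
    (limsup_lintegral_le (fun _ => ENNReal.ofReal C) (fun n => ?_) (fun n => ?_) ?_)
  · refine (Continuous.integrableOn_Icc ?_).mono_set Set.Ioo_subset_Icc_self
    fun_prop
  · fun_prop
  · filter_upwards [ae_restrict_mem measurableSet_Ioo] with t ht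
    refine ENNReal.ofReal_le_ofReal (hC t ht _ ⟨by positivity, ?_⟩)
    rw [div_le_one (by positivity)]
    simp
  · simp [ENNReal.mul_eq_top]

lemma injOn_sub_smul {E : Type*} [NormedAddCommGroup E] [NormedSpace ℝ E]
    {V : E → E} {S : Set E} {L : NNReal} (hV : LipschitzOnWith L V S)
    {ε : ℝ} (hε : 0 ≤ ε) (hεL : ε * L < 1) : Set.InjOn (fun y => y - ε • V y) S := by
  intro x hx y hy hxy
  have h1 : x - y = ε • (V x - V y) := by
    have : x - ε • V x = y - ε • V y := hxy
    rw [smul_sub, sub_eq_sub_iff_add_eq_add, ← sub_eq_sub_iff_add_eq_add]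
    exact sub_eq_sub_iff_sub_eq_sub.1 this ▸ rfl
  have h2 : ‖x - y‖ ≤ ε * (L * ‖x - y‖) := by
    conv_lhs => rw [h1]
    rw [norm_smul, Real.norm_of_nonneg hε]
    exact mul_le_mul_of_nonneg_left (hV.norm_sub_le hx hy) hε
  have h3 : ‖x - y‖ = 0 := by nlinarith [norm_nonneg (x - y)]
  exact sub_eq_zero.1 (norm_eq_zero.1 h3)

/-- Near-identity changes of variables on a compact convex set preserve integrals in the limit. -/
lemma tendsto_lintegral_det_mul {E : Type*} [NormedAddCommGroup E] [NormedSpace ℝ E]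
    [MeasurableSpace E] [BorelSpace E] (μ : Measure E)
    [μ.IsAddHaarMeasure] {V : E → E}
    (hV : ContDiff ℝ 1 V) {S : Set E} (hS : IsCompact S) {p : E → ℝ} (hp : Continuous p)
    {F : E → ℝ≥0∞} (hF : Measurable F) {B : ℝ≥0∞} (hB : B ≠ ∞) (hFB : ∀ x, F x ≤ B) {ε : ℕ → ℝ}
    (hε : Tendsto ε atTop (𝓝 0)) :
    Tendsto (fun k => ∫⁻ y in S, ENNReal.ofReal
        |(ContinuousLinearMap.id ℝ E - ε k • fderiv ℝ V y).det| *
          (ENNReal.ofReal (p (y - ε k • V y)) * F y) ∂μ) atTop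
      (𝓝 (∫⁻ y in S, ENNReal.ofReal (p y) * F y ∂μ)) := by
  have hVc := hV.continuous
  have hdV : Continuous (fderiv ℝ V) := hV.continuous_fderiv (by norm_num)
  set J : ℝ × E → ℝ := fun q => |(ContinuousLinearMap.id ℝ E - q.1 • fderiv ℝ V q.2).det|
  set Q : ℝ × E → ℝ := fun q => p (q.2 - q.1 • V q.2)
  have hJ : Continuous J := by
    have h1 : Continuous fun q : ℝ × E => ContinuousLinearMap.id ℝ E - q.1 • fderiv ℝ V q.2 := by
      fun_prop
    exact (ContinuousLinearMap.continuous_det.comp h1).abs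
  have hQ : Continuous Q := by fun_prop
  have hK : IsCompact (Set.Icc (-1 : ℝ) 1 ×ˢ S) := isCompact_Icc.prod hS
  obtain ⟨C₁, hC₁⟩ := hK.exists_bound_of_continuousOn hJ.continuousOn
  obtain ⟨C₂, hC₂⟩ := hK.exists_bound_of_continuousOn hQ.continuousOn
  have hmem : ∀ᶠ k in atTop, ε k ∈ Set.Icc (-1 : ℝ) 1 :=
    hε (Icc_mem_nhds (by norm_num) (by norm_num))
  refine tendsto_lintegral_filter_of_dominated_convergence
    (fun _ => ENNReal.ofReal C₁ * (ENNReal.ofReal C₂ * B)) (Eventually.of_forall fun k => ?_) ?_ ?_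
    (Eventually.of_forall fun y => ?_)
  · have h1 : Continuous fun y => J (ε k, y) := hJ.comp (by fun_prop)
    have h2 : Continuous fun y => Q (ε k, y) := hQ.comp (by fun_prop)
    exact h1.measurable.ennreal_ofReal.mul (h2.measurable.ennreal_ofReal.mul hF)
  · filter_upwards [hmem] with k hk
    filter_upwards [ae_restrict_mem hS.measurableSet] with y hy
    refine mul_le_mul' (ENNReal.ofReal_le_ofReal ?_)
      (mul_le_mul' (ENNReal.ofReal_le_ofReal ?_) (hFB y))
    · exact (le_abs_self _).trans (hC₁ (ε k, y) ⟨hk, hy⟩)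
    · exact (le_abs_self _).trans (hC₂ (ε k, y) ⟨hk, hy⟩)
  · rw [lintegral_const, Measure.restrict_apply_univ]
    exact ENNReal.mul_ne_top (by finiteness) hS.measure_lt_top.ne
  · have h0 : Tendsto (fun k => (ε k, y)) atTop (𝓝 ((0 : ℝ), y)) := hε.prodMk_nhds tendsto_const_nhds
    have h1 := (ENNReal.continuous_ofReal.tendsto _).comp ((hJ.tendsto (0, y)).comp h0)
    have h2 := (ENNReal.continuous_ofReal.tendsto _).comp ((hQ.tendsto (0, y)).comp h0)
    have hJ0 : J (0, y) = 1 := by simp [J, ContinuousLinearMap.det]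
    have hQ0 : Q (0, y) = p y := by simp [Q]
    rw [hJ0, ENNReal.ofReal_one] at h1
    rw [hQ0] at h2
    have h3 : Tendsto (fun k => ENNReal.ofReal (Q (ε k, y)) * F y) atTop
        (𝓝 (ENNReal.ofReal (p y) * F y)) :=
      ENNReal.Tendsto.mul_const h2 (Or.inr (ne_top_of_le_ne_top hB (hFB y)))
    have h4 := ENNReal.Tendsto.mul h1 (Or.inl one_ne_zero) h3 (Or.inr (by finiteness))
    rwa [one_mul] at h4

lemma limsup_lintegral_le_of_near_identity {E : Type*} [NormedAddCommGroup E] [NormedSpace ℝ E]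
    [FiniteDimensional ℝ E] [MeasurableSpace E] [BorelSpace E] (μ : Measure E)
    [μ.IsAddHaarMeasure] {V : E → E}
    (hV : ContDiff ℝ 1 V) {p : E → ℝ} (hp : Continuous p) (hpi : Integrable p μ)
    {F : E → ℝ≥0∞} (hF : Measurable F) {B : ℝ≥0∞} (hB : B ≠ ∞) (hFB : ∀ x, F x ≤ B) {ε : ℕ → ℝ}
    (hε : Tendsto ε atTop (𝓝 0)) (hε0 : ∀ k, 0 ≤ ε k) {K : ℕ → E → ℝ≥0∞}
    (hKB : ∀ k x, K k x ≤ ENNReal.ofReal (p x) * B)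
    (hK : ∀ᶠ k in atTop, ∀ x, K k x = 0 ∨ ∃ y, x = y - ε k • V y ∧ ‖x - y‖ ≤ 1 ∧
      K k x ≤ ENNReal.ofReal (p x) * F y) :
    limsup (fun k => ∫⁻ x, K k x ∂μ) atTop ≤ ∫⁻ x, ENNReal.ofReal (p x) * F x ∂μ := by
  have hVc := hV.continuous
  have hstep : ∀ R : ℝ, limsup (fun k => ∫⁻ x, K k x ∂μ) atTop
      ≤ (∫⁻ x, ENNReal.ofReal (p x) * F x ∂μ)
        + ∫⁻ x in (Metric.ball 0 R)ᶜ, ENNReal.ofReal (p x) * B ∂μ := by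
    intro R
    set S := Metric.closedBall (0 : E) (R + 1) with hS
    have hSc : IsCompact S := isCompact_closedBall _ _
    obtain ⟨L, hL⟩ := hV.contDiffOn.exists_lipschitzOnWith (by norm_num)
      (convex_closedBall (0 : E) (R + 1)) hSc
    have hεL : ∀ᶠ k in atTop, ε k * L < 1 := by
      have := hε.mul_const (L : ℝ)
      rw [zero_mul] at this
      exact this.eventually_lt_const one_pos
    have hbound : ∀ᶠ k in atTop, ∫⁻ x, K k x ∂μ ≤ (∫⁻ y in S, ENNReal.ofReal
        |(ContinuousLinearMap.id ℝ E - ε k • fderiv ℝ V y).det| *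
          (ENNReal.ofReal (p (y - ε k • V y)) * F y) ∂μ)
        + ∫⁻ x in (Metric.ball 0 R)ᶜ, ENNReal.ofReal (p x) * B ∂μ := by
      filter_upwards [hεL, hK] with k hk hKk
      rw [← lintegral_add_compl _ (Metric.isOpen_ball (x := (0 : E)) (ε := R)).measurableSet]
      refine add_le_add ?_ (lintegral_mono fun x => hKB k x)
      set T : E → E := fun y => y - ε k • V y with hT
      have hinj : Set.InjOn T S := injOn_sub_smul hL (hε0 k) hk
      have hTS : MeasurableSet (T '' S) := (hSc.image (by fun_prop)).measurableSet
      set g : E → ℝ≥0∞ := fun x => ENNReal.ofReal (p x) * F (Function.invFunOn T S x) with hg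
      have hd : ∀ y ∈ S, HasFDerivWithinAt T
          (ContinuousLinearMap.id ℝ E - ε k • fderiv ℝ V y) S y := fun y _ =>
        ((hasFDerivAt_id y).sub
          (((hV.differentiable (by norm_num) y).hasFDerivAt).const_smul (ε k))).hasFDerivWithinAt
      calc ∫⁻ x in Metric.ball 0 R, K k x ∂μ
          ≤ ∫⁻ x in Metric.ball 0 R, (T '' S).indicator g x ∂μ := by
            refine setLIntegral_mono' Metric.isOpen_ball.measurableSet fun x hx => ?_
            rcases hKk x with h0 | ⟨y, hy, hxy, hle⟩
            · simp [h0]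
            · have hyS : y ∈ S := by
                rw [hS, mem_closedBall_zero_iff]
                have h1 := norm_sub_norm_le y x
                rw [mem_ball_zero_iff] at hx
                rw [norm_sub_rev] at hxy
                linarith
              have hxS : x ∈ T '' S := ⟨y, hyS, hy.symm⟩
              rw [Set.indicator_of_mem hxS, hg]
              have : Function.invFunOn T S x = y := by
                have := hinj.leftInvOn_invFunOn hyS
                rwa [show T y = x from hy.symm] at this
              simpa only [this] using hle
        _ ≤ ∫⁻ x, (T '' S).indicator g x ∂μ := setLIntegral_le_lintegral _ _
        _ = ∫⁻ x in T '' S, g x ∂μ := lintegral_indicator hTS _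
        _ = _ := by
            rw [lintegral_image_eq_lintegral_abs_det_fderiv_mul μ hSc.measurableSet hd hinj g]
            refine setLIntegral_congr_fun hSc.measurableSet fun y hy => ?_
            simp only [hg, hinj.leftInvOn_invFunOn hy]
            rfl
    refine (limsup_le_limsup hbound).trans ?_
    have hlim := (tendsto_lintegral_det_mul μ hV hSc hp hF hB hFB hε).add_const
      (∫⁻ x in (Metric.ball 0 R)ᶜ, ENNReal.ofReal (p x) * B ∂μ)
    rw [hlim.limsup_eq]
    gcongr
    exact Measure.restrict_le_self
  have htail : Tendsto (fun n : ℕ => ∫⁻ x in (Metric.ball 0 (n : ℝ))ᶜ, ENNReal.ofReal (p x) * B ∂μ)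
      atTop (𝓝 0) := by
    have h0 : ∀ n : ℕ, MeasurableSet (Metric.ball (0 : E) (n : ℝ))ᶜ := fun n =>
      Metric.isOpen_ball.measurableSet.compl
    simp_rw [fun n => (lintegral_indicator (μ := μ) (h0 n) (fun x => ENNReal.ofReal (p x) * B)).symm]
    rw [← lintegral_zero (μ := μ) (α := E)]
    refine tendsto_lintegral_of_dominated_convergence (fun x => ENNReal.ofReal (p x) * B)
      (fun n => (by fun_prop : Measurable fun x => ENNReal.ofReal (p x) * B).indicator (h0 n))
      (fun n => Eventually.of_forall fun x => Set.indicator_le_self _ _ _) ?_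
      (Eventually.of_forall fun x => ?_)
    · rw [lintegral_mul_const _ (by fun_prop)]
      exact ENNReal.mul_ne_top hpi.lintegral_lt_top.ne hB
    · refine tendsto_const_nhds.congr' ?_
      filter_upwards [eventually_gt_atTop ⌈‖x‖⌉₊] with n hn
      rw [Set.indicator_of_notMem]
      simpa using (Nat.lt_of_ceil_lt hn)
  have hlim := (tendsto_const_nhds (x := ∫⁻ x, ENNReal.ofReal (p x) * F x ∂μ)).add htail
  rw [add_zero] at hlim
  exact ge_of_tendsto' hlim fun n => hstep n

lemma heatOp_neg (d : ℕ) (t : ℝ) (f : EuclideanSpace ℝ (Fin d) → ℝ)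
    (x : EuclideanSpace ℝ (Fin d)) : heatOp d t (fun y => -f y) x = -heatOp d t f x := by
  simp only [heatOp_eq_integral, integral_neg]

lemma continuous_heatOp (d : ℕ) (t : ℝ) {f : EuclideanSpace ℝ (Fin d) → ℝ} (hf : Continuous f)
    {M : ℝ} (hM : ∀ x, |f x| ≤ M) : Continuous (heatOp d t f) := by
  rw [funext (heatOp_eq_integral d t f)]
  exact continuous_of_dominated (fun x => Continuous.aestronglyMeasurable (by fun_prop))
    (fun x => Eventually.of_forall fun z => hM _) (integrable_const M)
    (Eventually.of_forall fun z => by fun_prop)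

/-- Semiconcave functions have heat increments bounded above. -/
lemma heatOp_sub_le {d : ℕ} {w : EuclideanSpace ℝ (Fin d) → ℝ} (hw : Continuous w) {M : ℝ}
    (hM : ∀ x, |w x| ≤ M) {y : EuclideanSpace ℝ (Fin d)} {c : ℝ}
    (hc : ∀ h, w (y + h) + w (y - h) - 2 * w y ≤ 2 * c * ‖h‖ ^ 2) {s : ℝ} (hs : 0 < s) :
    (heatOp d s w y - w y) / s ≤ c * ∫ z, ‖z‖ ^ 2 ∂heatMeasure d := by
  rw [div_le_iff₀ hs, heatOp_sub_eq_integral hw hM, mul_right_comm, ← integral_const_mul]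
  have h1 := integrable_comp_heatMeasure hw hM y (√s)
  have h2 := integrable_comp_heatMeasure hw hM y (-√s)
  simp only [neg_smul, ← sub_eq_add_neg] at h2
  refine integral_mono (((h1.add h2).sub (integrable_const _)).div_const 2)
    ((integrable_norm_sq_heatMeasure d).const_mul _) fun z => ?_
  have h3 := hc (√s • z)
  rw [norm_smul, mul_pow, Real.norm_eq_abs, sq_abs, Real.sq_sqrt hs.le] at h3
  dsimp only
  linarith

lemma heatKernel_add_le (d : ℕ) {τ s : ℝ} (hτ : 0 < τ) (hs : s ∈ Set.Ioc (0 : ℝ) 1)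
    (x : EuclideanSpace ℝ (Fin d)) :
    heatKernel d (τ + s) x
      ≤ (4 * Real.pi * τ) ^ (-(d : ℝ) / 2) * Real.exp (-(1 / (4 * (τ + 1))) * ‖x‖ ^ 2) := by
  have hs0 := hs.1
  have hs1 := hs.2
  rw [heatKernel_eq]
  refine mul_le_mul ?_ (Real.exp_le_exp.2 ?_) (Real.exp_nonneg _) (by positivity)
  · refine Real.rpow_le_rpow_of_nonpos (by positivity) (by gcongr; linarith) ?_
    have : (0 : ℝ) ≤ d := by positivity
    linarith
  · refine mul_le_mul_of_nonneg_right (neg_le_neg ?_) (sq_nonneg _)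
    gcongr

lemma continuousAt_heatKernel_time (d : ℕ) {τ : ℝ} (hτ : 0 < τ) (x : EuclideanSpace ℝ (Fin d)) :
    ContinuousAt (fun t => heatKernel d t x) τ := by
  unfold heatKernel
  refine ContinuousAt.mul (ContinuousAt.rpow (by fun_prop) (by fun_prop) (Or.inl (by positivity)))
    (Real.continuous_exp.continuousAt.comp (ContinuousAt.div (by fun_prop) (by fun_prop)
      (by positivity)))

/-- The integrand representing a left difference quotient of `t ↦ P_{T-t} U_t`. -/
noncomputable def slopeIntegrand (d : ℕ) (τ s : ℝ) (U₁ U₀ : EuclideanSpace ℝ (Fin d) → ℝ)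
    (x₀ x : EuclideanSpace ℝ (Fin d)) : ℝ :=
  heatKernel d τ (x₀ - x) * ((U₁ x - heatOp d s U₁ x) / s)
    + heatKernel d (τ + s) (x₀ - x) * ((U₁ x - U₀ x) / s)

section SlopeIntegrand

variable {d : ℕ} {τ s M : ℝ} {U₁ U₀ : EuclideanSpace ℝ (Fin d) → ℝ}

lemma continuous_slopeIntegrand (hU₁ : Continuous U₁) (hU₀ : Continuous U₀)
    (hM₁ : ∀ x, |U₁ x| ≤ M) (x₀ : EuclideanSpace ℝ (Fin d)) :
    Continuous (slopeIntegrand d τ s U₁ U₀ x₀) := by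
  unfold slopeIntegrand
  have h1 := continuous_heatKernel d τ
  have h2 := continuous_heatKernel d (τ + s)
  have h3 := continuous_heatOp d s hU₁ hM₁
  fun_prop

lemma slope_eq_integral (hτ : 0 < τ) (hs : 0 < s) (hU₁ : Continuous U₁) (hU₀ : Continuous U₀)
    (hM₁ : ∀ x, |U₁ x| ≤ M) (hM₀ : ∀ x, |U₀ x| ≤ M) (x₀ : EuclideanSpace ℝ (Fin d)) :
    Integrable (slopeIntegrand d τ s U₁ U₀ x₀) ∧
    (heatOp d τ U₁ x₀ - heatOp d (τ + s) U₀ x₀) / s = ∫ x, slopeIntegrand d τ s U₁ U₀ x₀ x := by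
  have hτs : 0 < τ + s := by positivity
  have i1 := integrable_heatKernel_mul d hτ hU₁.aestronglyMeasurable hM₁ x₀
  have i2 := integrable_heatKernel_mul d hτ (continuous_heatOp d s hU₁ hM₁).aestronglyMeasurable
    (abs_heatOp_le d s hM₁) x₀
  have i3 := integrable_heatKernel_mul d hτs hU₁.aestronglyMeasurable hM₁ x₀
  have i4 := integrable_heatKernel_mul d hτs hU₀.aestronglyMeasurable hM₀ x₀
  have heq : slopeIntegrand d τ s U₁ U₀ x₀ = fun x =>
      ((heatKernel d τ (x₀ - x) * U₁ x - heatKernel d τ (x₀ - x) * heatOp d s U₁ x)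
        + (heatKernel d (τ + s) (x₀ - x) * U₁ x - heatKernel d (τ + s) (x₀ - x) * U₀ x)) / s := by
    funext x
    unfold slopeIntegrand
    ring
  have hsg := heatOp_add d hs hτ hU₁ hM₁ x₀
  rw [heq]
  have i12 : Integrable fun x =>
      heatKernel d τ (x₀ - x) * U₁ x - heatKernel d τ (x₀ - x) * heatOp d s U₁ x := i1.sub i2
  have i34 : Integrable fun x =>
      heatKernel d (τ + s) (x₀ - x) * U₁ x - heatKernel d (τ + s) (x₀ - x) * U₀ x := i3.sub i4
  refine ⟨(i12.add i34).div_const s, ?_⟩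
  rw [integral_div, integral_add i12 i34, integral_sub i1 i2, integral_sub i3 i4]
  simp only [heatOp, not_le.2 hτ, not_le.2 hτs, if_false] at hsg ⊢
  rw [hsg]
  ring

end SlopeIntegrand

/-- Bounded functions, constant in time up to `a`, whose heat source is at most `f` on `(a, T)`
wherever they are positive. -/
structure IsPositiveSubsolution (d : ℕ) (a T M B : ℝ)
    (v f : ℝ → EuclideanSpace ℝ (Fin d) → ℝ) : Prop where
  continuous : Continuous fun p : ℝ × EuclideanSpace ℝ (Fin d) => v p.1 p.2
  abs_le : ∀ t x, |v t x| ≤ M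
  eq_of_le : ∀ t ≤ a, v t = v a
  differentiableAt : ∀ t ∈ Set.Ioo a T, ∀ x, DifferentiableAt ℝ (fun s => v s x) t
  contDiff : ∀ t ∈ Set.Ioo a T, ContDiff ℝ 2 (v t)
  measurable : Measurable fun p : ℝ × EuclideanSpace ℝ (Fin d) => f p.1 p.2
  source_nonneg : ∀ t ∈ Set.Ioo a T, ∀ x, 0 ≤ f t x
  source_le : ∀ t ∈ Set.Ioo a T, ∀ x, f t x ≤ B
  deriv_sub_laplacian_le : ∀ t ∈ Set.Ioo a T, ∀ x, 0 < v t x →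
    deriv (fun s => v s x) t - laplacian (v t) x ≤ f t x

/-- The sup-convolution in space of the positive part. -/
noncomputable def posSupConv {d : ℕ} (c : ℝ) (v : ℝ → EuclideanSpace ℝ (Fin d) → ℝ) (t : ℝ) :
    EuclideanSpace ℝ (Fin d) → ℝ :=
  supConv c fun x => max (v t x) 0

namespace IsPositiveSubsolution

variable {d : ℕ} {a T M B : ℝ} {v f : ℝ → EuclideanSpace ℝ (Fin d) → ℝ}
  {c : ℝ}

lemma bound_nonneg (h : IsPositiveSubsolution d a T M B v f) : 0 ≤ M :=
  (abs_nonneg _).trans (h.abs_le a 0)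

lemma continuous_at_time (h : IsPositiveSubsolution d a T M B v f) (t : ℝ) : Continuous (v t) :=
  h.continuous.comp (Continuous.prodMk_right t)

lemma continuous_max (h : IsPositiveSubsolution d a T M B v f) :
    Continuous fun p : ℝ × EuclideanSpace ℝ (Fin d) => max (v p.1 p.2) 0 :=
  h.continuous.max continuous_const

lemma continuous_max_at_time (h : IsPositiveSubsolution d a T M B v f)
    (t : ℝ) : Continuous fun x => max (v t x) 0 :=
  (h.continuous_at_time t).max continuous_const

lemma max_le (h : IsPositiveSubsolution d a T M B v f)
    (t : ℝ) (x : EuclideanSpace ℝ (Fin d)) : max (v t x) 0 ≤ M :=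
  _root_.max_le ((le_abs_self _).trans (h.abs_le t x)) h.bound_nonneg

lemma continuous_posSupConv (h : IsPositiveSubsolution d a T M B v f) (hc : 0 < c) :
    Continuous fun p : ℝ × EuclideanSpace ℝ (Fin d) => posSupConv c v p.1 p.2 :=
  continuous_supConv (u := fun t x => max (v t x) 0) hc h.continuous_max h.max_le
    fun _ _ => le_max_right _ _

lemma continuous_posSupConv_at_time (h : IsPositiveSubsolution d a T M B v f)
    (hc : 0 < c) (t : ℝ) : Continuous (posSupConv c v t) :=
  (h.continuous_posSupConv hc).comp (Continuous.prodMk_right t)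

lemma abs_posSupConv_le (h : IsPositiveSubsolution d a T M B v f)
    (hc : 0 < c) (t : ℝ) (x : EuclideanSpace ℝ (Fin d)) :
    |posSupConv c v t x| ≤ M :=
  abs_supConv_le hc.le (h.max_le t) (fun _ => le_max_right _ _) x

lemma posSupConv_nonneg (h : IsPositiveSubsolution d a T M B v f)
    (hc : 0 < c) (t : ℝ) (x : EuclideanSpace ℝ (Fin d)) :
    0 ≤ posSupConv c v t x :=
  (le_max_right (v t x) 0).trans (self_le_supConv (g := fun x => max (v t x) 0) hc.le (h.max_le t) x)

lemma le_posSupConv (h : IsPositiveSubsolution d a T M B v f)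
    (hc : 0 < c) (t : ℝ) (x z : EuclideanSpace ℝ (Fin d)) :
    v t (x + z) - c * ‖z‖ ^ 2 ≤ posSupConv c v t x :=
  (sub_le_sub_right (le_max_left _ _) _).trans
    (le_supConv (g := fun x => max (v t x) 0) hc.le (h.max_le t) x z)

lemma exists_contact (h : IsPositiveSubsolution d a T M B v f)
    (hc : 0 < c) (t : ℝ) (x : EuclideanSpace ℝ (Fin d)) :
    posSupConv c v t x = 0 ∨ ∃ z, ‖z‖ ≤ √(M / c) ∧ 0 < v t (x + z) ∧
      posSupConv c v t x = v t (x + z) - c * ‖z‖ ^ 2 ∧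
      ∀ z', v t (x + z') - c * ‖z'‖ ^ 2 ≤ v t (x + z) - c * ‖z‖ ^ 2 := by
  obtain ⟨z, hz, hz'⟩ := exists_supConv_eq (g := fun x => max (v t x) 0) hc
    (h.continuous_max_at_time t) (h.max_le t) (fun _ => le_max_right _ _) x
  rcases le_or_gt (v t (x + z)) 0 with hv | hv
  · left
    refine le_antisymm ?_ (h.posSupConv_nonneg hc t x)
    have : 0 ≤ c * ‖z‖ ^ 2 := by positivity
    rw [posSupConv, hz, max_eq_right hv]
    linarith
  · right
    rw [max_eq_left hv.le] at hz
    exact ⟨z, hz', hv, hz, fun z' => (h.le_posSupConv hc t x z').trans_eq hz⟩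

lemma laplacian_le_of_isMax (h : IsPositiveSubsolution d a T M B v f)
    (hc : 0 < c) {t : ℝ} (ht : t ∈ Set.Ioo a T)
    {x z : EuclideanSpace ℝ (Fin d)}
    (hz : ∀ z', v t (x + z') - c * ‖z'‖ ^ 2 ≤ v t (x + z) - c * ‖z‖ ^ 2) :
    laplacian (v t) (x + z) ≤ c * ∫ z, ‖z‖ ^ 2 ∂heatMeasure d := by
  refine le_of_tendsto (tendsto_heatOp_sub_div (h.contDiff t ht) (h.abs_le t) (x + z)) ?_
  filter_upwards [self_mem_nhdsWithin] with s hs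
  exact heatOp_sub_le (h.continuous_at_time t) (h.abs_le t) (secondDiff_le_of_isMax hc.le hz) hs

lemma source_bound_nonneg (h : IsPositiveSubsolution d a T M B v f)
    {t : ℝ} (ht : t ∈ Set.Ioo a T) : 0 ≤ B :=
  (h.source_nonneg t ht 0).trans (h.source_le t ht 0)

/-- Sup-convolution makes a subsolution one-sided Lipschitz in time. -/
lemma posSupConv_sub_le (h : IsPositiveSubsolution d a T M B v f)
    (hc : 0 < c) {t : ℝ} (ht : t ∈ Set.Ioo a T)
    (x : EuclideanSpace ℝ (Fin d)) {s : ℝ} (hs : 0 < s) :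
    posSupConv c v t x - posSupConv c v (t - s) x
      ≤ (B + c * ∫ z, ‖z‖ ^ 2 ∂heatMeasure d) * s := by
  have hm : 0 ≤ c * ∫ z, ‖z‖ ^ 2 ∂heatMeasure d :=
    mul_nonneg hc.le (integral_nonneg fun z => sq_nonneg _)
  have hC : 0 ≤ B + c * ∫ z, ‖z‖ ^ 2 ∂heatMeasure d := add_nonneg (h.source_bound_nonneg ht) hm
  refine sub_le_of_left_slope_lt (g := fun t => posSupConv c v t x) (a := a) (T := T)
    ((h.continuous_posSupConv hc).comp (Continuous.prodMk_left x)) hC ?_ ?_ ht hs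
  · intro t ht
    simp only [posSupConv, h.eq_of_le t ht]
  · intro t ht r hr
    rcases h.exists_contact hc t x with h0 | ⟨z, -, hpos, hU, hz⟩
    · filter_upwards [self_mem_nhdsWithin] with s hs
      refine lt_of_le_of_lt ?_ (hC.trans_lt hr)
      rw [h0, zero_sub]
      exact div_nonpos_of_nonpos_of_nonneg (neg_nonpos.2 (h.posSupConv_nonneg hc _ x))
        (le_of_lt hs)
    · have h1 := tendsto_left_slope (h.differentiableAt t ht (x + z)).hasDerivAt
      have h2 := h.deriv_sub_laplacian_le t ht (x + z) hpos
      have h3 := h.laplacian_le_of_isMax hc ht hz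
      have h4 := h.source_le t ht (x + z)
      filter_upwards [h1.eventually_lt_const (show _ < r by linarith), self_mem_nhdsWithin]
        with s hs hs0
      refine lt_of_le_of_lt ?_ hs
      refine div_le_div_of_nonneg_right ?_ (le_of_lt hs0)
      rw [hU]
      linarith [h.le_posSupConv hc (t - s) x z]

lemma posSupConv_sub_heatOp_le (h : IsPositiveSubsolution d a T M B v f)
    (hc : 0 < c) (t : ℝ) (x : EuclideanSpace ℝ (Fin d)) {s : ℝ}
    (hs : 0 < s) :
    (posSupConv c v t x - heatOp d s (posSupConv c v t) x) / s
      ≤ c * ∫ z, ‖z‖ ^ 2 ∂heatMeasure d := by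
  have h1 := heatOp_sub_le (w := fun x => -posSupConv c v t x) (y := x) (c := c)
    (h.continuous_posSupConv_at_time hc t).neg (M := M)
    (fun x => by rw [abs_neg]; exact h.abs_posSupConv_le hc t x) (fun k => by
      have := supConv_add_supConv hc (h.continuous_max_at_time t) (h.max_le t)
        (fun _ => le_max_right _ _) x k
      unfold posSupConv
      linarith) hs
  rw [heatOp_neg] at h1
  refine (le_of_eq ?_).trans h1
  ring

end IsPositiveSubsolution

/-- The upper limit of the left difference quotient integrands of `t ↦ P_{T-t} U_t`. -/
noncomputable def upperSlope {d : ℕ} (T c : ℝ) (v : ℝ → EuclideanSpace ℝ (Fin d) → ℝ)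
    (x₀ : EuclideanSpace ℝ (Fin d)) (t : ℝ) (x : EuclideanSpace ℝ (Fin d)) : ℝ≥0∞ :=
  limsup (fun n : ℕ => ENNReal.ofReal (slopeIntegrand d (T - t) (1 / ((n : ℝ) + 1))
    (posSupConv c v t) (posSupConv c v (t - 1 / ((n : ℝ) + 1))) x₀ x)) atTop

lemma one_div_add_one_mem_Ioc (n : ℕ) : 1 / ((n : ℝ) + 1) ∈ Set.Ioc (0 : ℝ) 1 := by
  refine ⟨by positivity, ?_⟩
  rw [div_le_one (by positivity)]
  simp

namespace IsPositiveSubsolution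

variable {d : ℕ} {a T M B : ℝ} {v f : ℝ → EuclideanSpace ℝ (Fin d) → ℝ}
  {c : ℝ}

lemma slopeIntegrand_le (h : IsPositiveSubsolution d a T M B v f)
    (hc : 0 < c) {t : ℝ} (ht : t ∈ Set.Ioo a T) {s : ℝ} (hs : 0 < s)
    (x₀ x : EuclideanSpace ℝ (Fin d)) :
    slopeIntegrand d (T - t) s (posSupConv c v t) (posSupConv c v (t - s)) x₀ x
      ≤ heatKernel d (T - t) (x₀ - x) * (c * ∫ z, ‖z‖ ^ 2 ∂heatMeasure d)
        + heatKernel d (T - t + s) (x₀ - x) * (B + c * ∫ z, ‖z‖ ^ 2 ∂heatMeasure d) := by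
  have hτ : 0 < T - t := sub_pos.2 ht.2
  refine add_le_add
    (mul_le_mul_of_nonneg_left (h.posSupConv_sub_heatOp_le hc t x hs) (heatKernel_nonneg d hτ _))
    (mul_le_mul_of_nonneg_left ?_ (heatKernel_nonneg d (by positivity) _))
  rw [div_le_iff₀ hs]
  exact h.posSupConv_sub_le hc ht x hs

lemma slope_eq (h : IsPositiveSubsolution d a T M B v f)
    (hc : 0 < c) {t : ℝ} (ht : t ∈ Set.Ioo a T) {s : ℝ} (hs : 0 < s)
    (x₀ : EuclideanSpace ℝ (Fin d)) :
    Integrable (slopeIntegrand d (T - t) s (posSupConv c v t) (posSupConv c v (t - s)) x₀) ∧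
    (heatOp d (T - t) (posSupConv c v t) x₀
        - heatOp d (T - (t - s)) (posSupConv c v (t - s)) x₀) / s
      = ∫ x, slopeIntegrand d (T - t) s (posSupConv c v t) (posSupConv c v (t - s)) x₀ x := by
  rw [show T - (t - s) = T - t + s by ring]
  exact slope_eq_integral (sub_pos.2 ht.2) hs (h.continuous_posSupConv_at_time hc _)
    (h.continuous_posSupConv_at_time hc _) (h.abs_posSupConv_le hc _) (h.abs_posSupConv_le hc _) x₀

lemma slope_le (h : IsPositiveSubsolution d a T M B v f)
    (hc : 0 < c) {t : ℝ} (ht : t ∈ Set.Ioo a T) {s : ℝ} (hs : 0 < s)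
    (x₀ : EuclideanSpace ℝ (Fin d)) :
    (heatOp d (T - t) (posSupConv c v t) x₀
        - heatOp d (T - (t - s)) (posSupConv c v (t - s)) x₀) / s
      ≤ (c * ∫ z, ‖z‖ ^ 2 ∂heatMeasure d) + (B + c * ∫ z, ‖z‖ ^ 2 ∂heatMeasure d) := by
  have hτ : 0 < T - t := sub_pos.2 ht.2
  have hτs : 0 < T - t + s := by positivity
  obtain ⟨hi, he⟩ := h.slope_eq hc ht hs x₀
  have i1 := (integrable_heatKernel_sub d hτ x₀).mul_const (c * ∫ z, ‖z‖ ^ 2 ∂heatMeasure d)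
  have i2 := (integrable_heatKernel_sub d hτs x₀).mul_const
    (B + c * ∫ z, ‖z‖ ^ 2 ∂heatMeasure d)
  rw [he]
  refine (integral_mono hi (i1.add i2) fun x => h.slopeIntegrand_le hc ht hs x₀ x).trans ?_
  simp only [Pi.add_apply]
  rw [integral_add i1 i2, integral_mul_const, integral_mul_const, integral_heatKernel_sub d hτ,
    integral_heatKernel_sub d hτs, one_mul, one_mul]

lemma upperSlope_le (h : IsPositiveSubsolution d a T M B v f)
    (hc : 0 < c) {t : ℝ} (ht : t ∈ Set.Ioo a T)
    (x₀ x : EuclideanSpace ℝ (Fin d)) :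
    upperSlope T c v x₀ t x = 0 ∨ ∃ y, x = y - (1 / (2 * c)) • gradient (v t) y ∧
      ‖x - y‖ ≤ √(M / c) ∧ upperSlope T c v x₀ t x
        ≤ ENNReal.ofReal (heatKernel d (T - t) (x₀ - x)) * ENNReal.ofReal (f t y) := by
  have hτ : 0 < T - t := sub_pos.2 ht.2
  rcases h.exists_contact hc t x with h0 | ⟨z, hzc, hpos, hU, hz⟩
  · left
    have hle : ∀ n : ℕ, ENNReal.ofReal (slopeIntegrand d (T - t) (1 / ((n : ℝ) + 1))
        (posSupConv c v t) (posSupConv c v (t - 1 / ((n : ℝ) + 1))) x₀ x) = 0 := by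
      intro n
      have hs : 0 < 1 / ((n : ℝ) + 1) := by positivity
      rw [ENNReal.ofReal_eq_zero, slopeIntegrand, h0, zero_sub, zero_sub]
      refine add_nonpos (mul_nonpos_of_nonneg_of_nonpos (heatKernel_nonneg d hτ _)
        (div_nonpos_of_nonpos_of_nonneg (neg_nonpos.2 ?_) hs.le))
        (mul_nonpos_of_nonneg_of_nonpos (heatKernel_nonneg d (by positivity) _)
        (div_nonpos_of_nonpos_of_nonneg (neg_nonpos.2 (h.posSupConv_nonneg hc _ x)) hs.le))
      rw [heatOp_eq_integral]
      exact integral_nonneg fun z => h.posSupConv_nonneg hc _ _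
    simp only [upperSlope, hle, limsup_const]
  · right
    refine ⟨x + z, eq_of_isMax hc ((h.contDiff t ht).differentiable (by norm_num)) hz,
      by simpa using hzc, ?_⟩
    set y := x + z with hy
    have h1 := (tendsto_left_slope (h.differentiableAt t ht y).hasDerivAt)
    have h2 := (tendsto_heatOp_sub_div (h.contDiff t ht) (h.abs_le t) y).neg
    have h3 : Tendsto (fun s => heatKernel d (T - t + s) (x₀ - x)) (𝓝[>] 0)
        (𝓝 (heatKernel d (T - t) (x₀ - x))) := by
      have h4 : Tendsto (fun s => T - t + s) (𝓝[>] 0) (𝓝 (T - t)) := by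
        have : Tendsto (fun s => T - t + s) (𝓝 0) (𝓝 (T - t + 0)) :=
          (continuous_const.add continuous_id).tendsto 0
        rw [add_zero] at this
        exact this.mono_left nhdsWithin_le_nhds
      exact (continuousAt_heatKernel_time d hτ (x₀ - x)).tendsto.comp h4
    have h5 := ((h2.const_mul (heatKernel d (T - t) (x₀ - x))).add (h3.mul h1)).comp
      tendsto_inv_add_one_nhdsGT
    have h6 := (ENNReal.continuous_ofReal.tendsto _).comp h5
    refine (limsup_le_limsup (Eventually.of_forall fun n => ?_)).trans (h6.limsup_eq.trans_le ?_)
    · have hs : 0 < 1 / ((n : ℝ) + 1) := by positivity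
      refine ENNReal.ofReal_le_ofReal ?_
      refine add_le_add (mul_le_mul_of_nonneg_left ?_ (heatKernel_nonneg d hτ _))
        (mul_le_mul_of_nonneg_left ?_ (heatKernel_nonneg d (by positivity) _))
      · rw [← neg_div, neg_sub]
        refine div_le_div_of_nonneg_right ?_ hs.le
        rw [hU, sub_sub]
        have : heatOp d (1 / ((n : ℝ) + 1)) (v t) y - c * ‖z‖ ^ 2
            ≤ heatOp d (1 / ((n : ℝ) + 1)) (posSupConv c v t) x := by
          rw [heatOp_eq_integral, heatOp_eq_integral]
          have i1 := integrable_comp_heatMeasure (h.continuous_at_time t) (h.abs_le t) y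
            (√(1 / ((n : ℝ) + 1)))
          have hconst : c * ‖z‖ ^ 2 = ∫ _, c * ‖z‖ ^ 2 ∂heatMeasure d := by simp
          rw [hconst, ← integral_sub i1 (integrable_const _)]
          refine integral_mono (i1.sub (integrable_const _)) (integrable_comp_heatMeasure
            (h.continuous_posSupConv_at_time hc t) (h.abs_posSupConv_le hc t) x _) fun k => ?_
          have := h.le_posSupConv hc t (x + √(1 / ((n : ℝ) + 1)) • k) z
          rwa [add_right_comm] at this
        linarith
      · refine div_le_div_of_nonneg_right ?_ hs.le
        rw [hU]
        linarith [h.le_posSupConv hc (t - 1 / ((n : ℝ) + 1)) x z]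
    · rw [← ENNReal.ofReal_mul (heatKernel_nonneg d hτ _), ← mul_add]
      refine ENNReal.ofReal_le_ofReal
        (mul_le_mul_of_nonneg_left ?_ (heatKernel_nonneg d hτ _))
      linarith [h.deriv_sub_laplacian_le t ht y hpos]

lemma upperSlope_le_mul_bound (h : IsPositiveSubsolution d a T M B v f)
    (hc : 0 < c) {t : ℝ} (ht : t ∈ Set.Ioo a T)
    (x₀ x : EuclideanSpace ℝ (Fin d)) : upperSlope T c v x₀ t x
      ≤ ENNReal.ofReal (heatKernel d (T - t) (x₀ - x)) * ENNReal.ofReal B := by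
  rcases h.upperSlope_le hc ht x₀ x with h0 | ⟨y, -, -, hy⟩
  · simp [h0]
  · exact hy.trans (by gcongr; exact h.source_le t ht y)

lemma limsup_slope_le (h : IsPositiveSubsolution d a T M B v f)
    (hc : 0 < c) {t : ℝ} (ht : t ∈ Set.Ioo a T)
    (x₀ : EuclideanSpace ℝ (Fin d)) :
    limsup (fun n : ℕ => ENNReal.ofReal ((heatOp d (T - t) (posSupConv c v t) x₀
        - heatOp d (T - (t - 1 / ((n : ℝ) + 1))) (posSupConv c v (t - 1 / ((n : ℝ) + 1))) x₀)
          / (1 / ((n : ℝ) + 1)))) atTop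
      ≤ ∫⁻ x, upperSlope T c v x₀ t x := by
  have hτ : 0 < T - t := sub_pos.2 ht.2
  have hm : 0 ≤ c * ∫ z, ‖z‖ ^ 2 ∂heatMeasure d :=
    mul_nonneg hc.le (integral_nonneg fun z => sq_nonneg _)
  have hC : 0 ≤ B + c * ∫ z, ‖z‖ ^ 2 ∂heatMeasure d := add_nonneg (h.source_bound_nonneg ht) hm
  refine (limsup_le_limsup (Eventually.of_forall fun n => ?_)).trans (limsup_lintegral_le
    (fun x => ENNReal.ofReal (heatKernel d (T - t) (x₀ - x) * (c * ∫ z, ‖z‖ ^ 2 ∂heatMeasure d)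
      + (4 * Real.pi * (T - t)) ^ (-(d : ℝ) / 2)
        * Real.exp (-(1 / (4 * (T - t + 1))) * ‖x₀ - x‖ ^ 2)
        * (B + c * ∫ z, ‖z‖ ^ 2 ∂heatMeasure d)))
    (fun n => ?_) (fun n => Eventually.of_forall fun x => ?_) ?_)
  · obtain ⟨hi, he⟩ := h.slope_eq hc ht (one_div_add_one_mem_Ioc n).1 x₀
    rw [he]
    exact ofReal_integral_le_lintegral hi
  · exact (continuous_slopeIntegrand (h.continuous_posSupConv_at_time hc _)
      (h.continuous_posSupConv_at_time hc _) (h.abs_posSupConv_le hc _) x₀).measurable.ennreal_ofReal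
  · refine ENNReal.ofReal_le_ofReal
      ((h.slopeIntegrand_le hc ht (one_div_add_one_mem_Ioc n).1 x₀ x).trans ?_)
    gcongr
    exact heatKernel_add_le d hτ (one_div_add_one_mem_Ioc n) _
  · have i1 := (integrable_heatKernel_sub d hτ x₀).mul_const (c * ∫ z, ‖z‖ ^ 2 ∂heatMeasure d)
    have i2 := (((integrable_exp_neg_mul_norm_sq d (b := 1 / (4 * (T - t + 1)))
      (by positivity)).comp_sub_left x₀).const_mul
      ((4 * Real.pi * (T - t)) ^ (-(d : ℝ) / 2))).mul_const
      (B + c * ∫ z, ‖z‖ ^ 2 ∂heatMeasure d)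
    exact (i1.add i2).lintegral_lt_top.ne

lemma continuous_heatOp_posSupConv (h : IsPositiveSubsolution d a T M B v f)
    (hc : 0 < c) (x₀ : EuclideanSpace ℝ (Fin d)) :
    Continuous fun t => heatOp d (T - t) (posSupConv c v t) x₀ := by
  simp_rw [heatOp_eq_integral]
  have hU := h.continuous_posSupConv hc
  refine continuous_of_dominated (bound := fun _ => M) (fun t => ?_)
    (fun t => Eventually.of_forall fun z => h.abs_posSupConv_le hc _ _) (integrable_const M)
    (Eventually.of_forall fun z => ?_)
  · exact (integrable_comp_heatMeasure (h.continuous_posSupConv_at_time hc t)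
      (h.abs_posSupConv_le hc t) x₀ _).aestronglyMeasurable
  · exact hU.comp (f := fun t => (t, x₀ + √(T - t) • z)) (by fun_prop)

lemma ofReal_posSupConv_sub_le (h : IsPositiveSubsolution d a T M B v f)
    (haT : a < T) (hc : 0 < c) (x₀ : EuclideanSpace ℝ (Fin d)) :
    ENNReal.ofReal (posSupConv c v T x₀ - heatOp d (T - a) (posSupConv c v a) x₀)
      ≤ ∫⁻ t in Set.Ioo a T, limsup (fun n : ℕ => ENNReal.ofReal
        ((heatOp d (T - t) (posSupConv c v t) x₀
        - heatOp d (T - (t - 1 / ((n : ℝ) + 1))) (posSupConv c v (t - 1 / ((n : ℝ) + 1))) x₀)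
          / (1 / ((n : ℝ) + 1)))) atTop := by
  have := ofReal_sub_le_lintegral_limsup haT (h.continuous_heatOp_posSupConv hc x₀)
    (fun t ht s hs => h.slope_le hc ht hs.1 x₀)
  simpa [heatOp] using this

end IsPositiveSubsolution

lemma contDiff_gradient {E : Type*} [NormedAddCommGroup E] [InnerProductSpace ℝ E]
    [CompleteSpace E] {w : E → ℝ} (hw : ContDiff ℝ 2 w) : ContDiff ℝ 1 (gradient w) :=
  (InnerProductSpace.toDual ℝ E).symm.contDiff.comp (hw.fderiv_right (by norm_num))

namespace IsPositiveSubsolution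

variable {d : ℕ} {a T M B : ℝ} {v f : ℝ → EuclideanSpace ℝ (Fin d) → ℝ}

lemma measurable_source (h : IsPositiveSubsolution d a T M B v f) (t : ℝ) : Measurable (f t) :=
  h.measurable.comp measurable_prodMk_left

lemma abs_source_le (h : IsPositiveSubsolution d a T M B v f)
    {t : ℝ} (ht : t ∈ Set.Ioo a T) (x : EuclideanSpace ℝ (Fin d)) :
    |f t x| ≤ B := by
  rw [abs_of_nonneg (h.source_nonneg t ht x)]
  exact h.source_le t ht x

lemma lintegral_heatKernel_mul_source (h : IsPositiveSubsolution d a T M B v f)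
    {t : ℝ} (ht : t ∈ Set.Ioo a T)
    (x₀ : EuclideanSpace ℝ (Fin d)) :
    ∫⁻ x, ENNReal.ofReal (heatKernel d (T - t) (x₀ - x)) * ENNReal.ofReal (f t x)
      = ENNReal.ofReal (heatOp d (T - t) (f t) x₀) := by
  have hτ : 0 < T - t := sub_pos.2 ht.2
  rw [heatOp, if_neg (not_le.2 hτ), ofReal_integral_eq_lintegral_ofReal
    (integrable_heatKernel_mul d hτ (h.measurable_source t).aestronglyMeasurable
      (h.abs_source_le ht) x₀)
    (Eventually.of_forall fun x => mul_nonneg (heatKernel_nonneg d hτ _) (h.source_nonneg t ht x))]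
  simp_rw [ENNReal.ofReal_mul (heatKernel_nonneg d hτ _)]

lemma integrableOn_heatOp_source (h : IsPositiveSubsolution d a T M B v f)
    (x₀ : EuclideanSpace ℝ (Fin d)) :
    IntegrableOn (fun t => heatOp d (T - t) (f t) x₀) (Set.Ioo a T) := by
  have h1 : StronglyMeasurable fun t => ∫ x, heatKernel d (T - t) (x₀ - x) * f t x := by
    refine StronglyMeasurable.integral_prod_right
      (f := fun (t : ℝ) x => heatKernel d (T - t) (x₀ - x) * f t x) ?_
    refine Measurable.stronglyMeasurable (Measurable.mul ?_ h.measurable)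
    unfold heatKernel
    fun_prop
  refine (integrable_const B).mono' (h1.aestronglyMeasurable.congr ?_) ?_
  · filter_upwards [ae_restrict_mem measurableSet_Ioo] with t ht
    rw [heatOp, if_neg (not_le.2 (sub_pos.2 ht.2))]
  · filter_upwards [ae_restrict_mem measurableSet_Ioo] with t ht
    exact abs_heatOp_le d _ (h.abs_source_le ht) x₀

lemma lintegral_heatOp_source (h : IsPositiveSubsolution d a T M B v f)
    (haT : a < T) (x₀ : EuclideanSpace ℝ (Fin d)) :
    ∫⁻ t in Set.Ioo a T, ∫⁻ x, ENNReal.ofReal (heatKernel d (T - t) (x₀ - x))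
        * ENNReal.ofReal (f t x)
      = ENNReal.ofReal (∫ t in a..T, heatOp d (T - t) (f t) x₀) := by
  rw [setLIntegral_congr_fun measurableSet_Ioo
    (fun t ht => h.lintegral_heatKernel_mul_source ht x₀),
    intervalIntegral.integral_of_le haT.le, integral_Ioc_eq_integral_Ioo,
    ofReal_integral_eq_lintegral_ofReal (h.integrableOn_heatOp_source x₀)]
  filter_upwards [ae_restrict_mem measurableSet_Ioo] with t ht
  rw [heatOp_eq_integral]
  exact integral_nonneg fun z => h.source_nonneg t ht _

lemma limsup_lintegral_upperSlope_le (h : IsPositiveSubsolution d a T M B v f)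
    {t : ℝ} (ht : t ∈ Set.Ioo a T)
    (x₀ : EuclideanSpace ℝ (Fin d)) :
    limsup (fun k : ℕ => ∫⁻ x, upperSlope T ((k : ℝ) + 1) v x₀ t x) atTop
      ≤ ∫⁻ x, ENNReal.ofReal (heatKernel d (T - t) (x₀ - x)) * ENNReal.ofReal (f t x) := by
  have hτ : 0 < T - t := sub_pos.2 ht.2
  have hk0 : ∀ k : ℕ, (0 : ℝ) < k + 1 := fun k => by positivity
  have hk : Tendsto (fun k : ℕ => (k : ℝ) + 1) atTop atTop :=
    tendsto_atTop_add_const_right _ _ tendsto_natCast_atTop_atTop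
  have hpc := continuous_heatKernel d (T - t)
  refine limsup_lintegral_le_of_near_identity volume (contDiff_gradient (h.contDiff t ht))
    (ε := fun k : ℕ => 1 / (2 * ((k : ℝ) + 1))) (B := ENNReal.ofReal B)
    (by fun_prop) (integrable_heatKernel_sub d hτ x₀) (h.measurable_source t).ennreal_ofReal
    ENNReal.ofReal_ne_top (fun x => ENNReal.ofReal_le_ofReal (h.source_le t ht x)) ?_
    (fun k => by positivity) (fun k x => h.upperSlope_le_mul_bound (hk0 k) ht x₀ x) ?_
  · exact tendsto_const_nhds.div_atTop (hk.const_mul_atTop two_pos)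
  · have h1 : Tendsto (fun k : ℕ => √(M / ((k : ℝ) + 1))) atTop (𝓝 0) := by
      have : Tendsto (fun k : ℕ => M / ((k : ℝ) + 1)) atTop (𝓝 0) := tendsto_const_nhds.div_atTop hk
      simpa using this.sqrt
    filter_upwards [h1.eventually_lt_const one_pos] with k hk1 x
    rcases h.upperSlope_le (hk0 k) ht x₀ x with h0 | ⟨y, hy, hxy, hle⟩
    · exact Or.inl h0
    · exact Or.inr ⟨y, hy, hxy.trans hk1.le, hle⟩

lemma lintegral_upperSlope_le (h : IsPositiveSubsolution d a T M B v f)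
    {c : ℝ} (hc : 0 < c) {t : ℝ} (ht : t ∈ Set.Ioo a T)
    (x₀ : EuclideanSpace ℝ (Fin d)) :
    ∫⁻ x, upperSlope T c v x₀ t x ≤ ENNReal.ofReal B := by
  have hτ : 0 < T - t := sub_pos.2 ht.2
  have hpc := continuous_heatKernel d (T - t)
  refine (lintegral_mono fun x => h.upperSlope_le_mul_bound hc ht x₀ x).trans ?_
  rw [lintegral_mul_const _ (by fun_prop), ← ofReal_integral_eq_lintegral_ofReal
    (integrable_heatKernel_sub d hτ x₀) (Eventually.of_forall fun x => heatKernel_nonneg d hτ _),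
    integral_heatKernel_sub d hτ, ENNReal.ofReal_one, one_mul]

lemma tendsto_heatOp_posSupConv (h : IsPositiveSubsolution d a T M B v f)
    (x₀ : EuclideanSpace ℝ (Fin d)) :
    Tendsto (fun k : ℕ => heatOp d (T - a) (posSupConv ((k : ℝ) + 1) v a) x₀) atTop
      (𝓝 (heatOp d (T - a) (fun x => max (v a x) 0) x₀)) := by
  have hk0 : ∀ k : ℕ, (0 : ℝ) < k + 1 := fun k => by positivity
  have hk : Tendsto (fun k : ℕ => (k : ℝ) + 1) atTop atTop :=
    tendsto_atTop_add_const_right _ _ tendsto_natCast_atTop_atTop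
  simp_rw [heatOp_eq_integral]
  refine tendsto_integral_of_dominated_convergence (fun _ => M)
    (fun k => (integrable_comp_heatMeasure (h.continuous_posSupConv_at_time (hk0 k) a)
        (h.abs_posSupConv_le (hk0 k) a) x₀ _).aestronglyMeasurable) (integrable_const M)
    (fun k => Eventually.of_forall fun z => h.abs_posSupConv_le (hk0 k) _ _)
    (Eventually.of_forall fun z => ?_)
  exact (tendsto_supConv (g := fun x => max (v a x) 0) (h.continuous_max_at_time a) (h.max_le a)
    (fun _ => le_max_right _ _) _).comp hk

/-- Duhamel comparison for subsolutions of the heat equation where they are positive. -/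
theorem le_heatOp_add_integral (h : IsPositiveSubsolution d a T M B v f)
    (haT : a < T) (x₀ : EuclideanSpace ℝ (Fin d)) :
    v T x₀ ≤ heatOp d (T - a) (fun x => max (v a x) 0) x₀
      + ∫ t in a..T, heatOp d (T - t) (f t) x₀ := by
  have hk0 : ∀ k : ℕ, (0 : ℝ) < k + 1 := fun k => by positivity
  have hk : Tendsto (fun k : ℕ => (k : ℝ) + 1) atTop atTop :=
    tendsto_atTop_add_const_right _ _ tendsto_natCast_atTop_atTop
  have hlim : Tendsto (fun k : ℕ => ENNReal.ofReal (posSupConv ((k : ℝ) + 1) v T x₀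
      - heatOp d (T - a) (posSupConv ((k : ℝ) + 1) v a) x₀)) atTop
      (𝓝 (ENNReal.ofReal (max (v T x₀) 0 - heatOp d (T - a) (fun x => max (v a x) 0) x₀))) :=
    (ENNReal.continuous_ofReal.tendsto _).comp (((tendsto_supConv (g := fun x => max (v T x) 0)
      (h.continuous_max_at_time T) (h.max_le T) (fun _ => le_max_right _ _) x₀).comp hk).sub
      (h.tendsto_heatOp_posSupConv x₀))
  have hmain : ENNReal.ofReal (max (v T x₀) 0 - heatOp d (T - a) (fun x => max (v a x) 0) x₀)
      ≤ ENNReal.ofReal (∫ t in a..T, heatOp d (T - t) (f t) x₀) := by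
    rw [← hlim.limsup_eq, ← h.lintegral_heatOp_source haT x₀]
    refine (limsup_le_limsup (Eventually.of_forall fun k =>
      h.ofReal_posSupConv_sub_le haT (hk0 k) x₀)).trans ?_
    refine (limsup_lintegral_le (fun _ => ENNReal.ofReal B) (fun k => ?_) (fun k => ?_) ?_).trans ?_
    · refine Measurable.limsup fun n => ?_
      have := h.continuous_heatOp_posSupConv (hk0 k) x₀
      have h2 := this.comp (continuous_sub_right (1 / ((n : ℝ) + 1)))
      exact ((this.sub h2).div_const _).measurable.ennreal_ofReal
    · filter_upwards [ae_restrict_mem measurableSet_Ioo] with t ht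
      exact (h.limsup_slope_le (hk0 k) ht x₀).trans (h.lintegral_upperSlope_le (hk0 k) ht x₀)
    · simp [ENNReal.mul_eq_top]
    · refine setLIntegral_mono' measurableSet_Ioo fun t ht => ?_
      exact (limsup_le_limsup (Eventually.of_forall fun k =>
        h.limsup_slope_le (hk0 k) ht x₀)).trans (h.limsup_lintegral_upperSlope_le ht x₀)
  have hnn : 0 ≤ ∫ t in a..T, heatOp d (T - t) (f t) x₀ := by
    rw [intervalIntegral.integral_of_le haT.le, integral_Ioc_eq_integral_Ioo]
    refine setIntegral_nonneg measurableSet_Ioo fun t ht => ?_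
    rw [heatOp_eq_integral]
    exact integral_nonneg fun z => h.source_nonneg t ht _
  rw [ENNReal.ofReal_le_ofReal_iff hnn] at hmain
  linarith [le_max_left (v T x₀) 0]

end IsPositiveSubsolution

lemma heatOp_const_mul (d : ℕ) (t k : ℝ) (g : EuclideanSpace ℝ (Fin d) → ℝ)
    (x : EuclideanSpace ℝ (Fin d)) : heatOp d t (fun y => k * g y) x = k * heatOp d t g x := by
  simp only [heatOp_eq_integral, integral_const_mul]

lemma laplacian_const_mul {d : ℕ} {g : EuclideanSpace ℝ (Fin d) → ℝ} (hg : ContDiff ℝ 2 g) (k : ℝ)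
    (x : EuclideanSpace ℝ (Fin d)) : laplacian (fun y => k * g y) x = k * laplacian g x := by
  have h1 : Differentiable ℝ g := hg.differentiable (by norm_num)
  have h2 : Differentiable ℝ (fderiv ℝ g) :=
    (hg.fderiv_right (m := 1) (by norm_num)).differentiable (by norm_num)
  simp only [laplacian, Finset.mul_sum]
  refine Finset.sum_congr rfl fun i _ => ?_
  have h3 : (fun y => fderiv ℝ (fun y => k * g y) y (EuclideanSpace.single i 1))
      = fun y => k * fderiv ℝ g y (EuclideanSpace.single i 1) := by
    funext y
    rw [fderiv_const_mul (h1 y)]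
    rfl
  rw [h3, fderiv_const_mul (by fun_prop)]
  rfl

/-- The one-sided form of the maximum principle. -/
lemma le_heatOp_add_integral_of_pde {d : ℕ} {a b : ℝ}
    {v G R : ℝ → EuclideanSpace ℝ (Fin d) → ℝ}
    (hv_cont : ContinuousOn (fun p : ℝ × EuclideanSpace ℝ (Fin d) => v p.1 p.2)
      (Set.Icc a b ×ˢ Set.univ))
    (hv_bdd : ∃ M : ℝ, ∀ t ∈ Set.Icc a b, ∀ x, |v t x| ≤ M)
    (hv_time : ∀ t ∈ Set.Ioo a b, ∀ x, DifferentiableAt ℝ (fun s => v s x) t)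
    (hv_space : ∀ t ∈ Set.Ioo a b, ContDiff ℝ 2 (v t))
    (hR_meas : Measurable (fun p : ℝ × EuclideanSpace ℝ (Fin d) => R p.1 p.2))
    (hG_nonneg : ∀ t ∈ Set.Ioo a b, ∀ x, 0 ≤ G t x)
    (hR_bdd : ∃ M : ℝ, ∀ t ∈ Set.Ioo a b, ∀ x, |R t x| ≤ M)
    (hpde : ∀ t ∈ Set.Ioo a b, ∀ x,
      deriv (fun s => v s x) t - laplacian (v t) x - v t x = -(G t x) * v t x + R t x)
    {T : ℝ} (hT : T ∈ Set.Ioc a b) (x : EuclideanSpace ℝ (Fin d)) :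
    v T x ≤ Real.exp (T - a) * heatOp d (T - a) (fun y => |v a y|) x +
      ∫ s in a..T, Real.exp (T - s) * heatOp d (T - s) (fun y => |R s y|) x := by
  obtain ⟨M, hM⟩ := hv_bdd
  obtain ⟨N, hN⟩ := hR_bdd
  have haT := hT.1
  set cl : ℝ → ℝ := fun s => max a (min s T) with hcl
  have hclc : Continuous cl := by fun_prop
  have hcl_mem : ∀ s, cl s ∈ Set.Icc a b := fun s =>
    ⟨le_max_left _ _, max_le (haT.le.trans hT.2) ((min_le_right _ _).trans hT.2)⟩
  have hcl_a : ∀ s ≤ a, cl s = a := fun s hs => max_eq_left ((min_le_left _ _).trans hs)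
  have hcl_of_mem : ∀ s ∈ Set.Icc a T, cl s = s := fun s hs => by
    simp only [hcl, min_eq_left hs.2, max_eq_right hs.1]
  have hsub : Set.Ioo a T ⊆ Set.Ioo a b := Set.Ioo_subset_Ioo_right hT.2
  set w : ℝ → EuclideanSpace ℝ (Fin d) → ℝ := fun s y => Real.exp (-cl s) * v (cl s) y with hw
  have hw_of_mem : ∀ s ∈ Set.Icc a T, w s = fun y => Real.exp (-s) * v s y := fun s hs => by
    simp only [hw, hcl_of_mem s hs]
  have hderiv : ∀ t ∈ Set.Ioo a T, ∀ y, HasDerivAt (fun s => w s y)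
      (Real.exp (-t) * (deriv (fun s => v s y) t - v t y)) t := by
    intro t ht y
    have h1 := ((hasDerivAt_id t).neg.exp).mul (hv_time t (hsub ht) y).hasDerivAt
    refine (h1.congr_of_eventuallyEq ?_).congr_deriv ?_
    · filter_upwards [Ioo_mem_nhds ht.1 ht.2] with s hs
      rw [hw_of_mem s (Set.Ioo_subset_Icc_self hs)]
      rfl
    · simp only [id, Pi.neg_apply]
      ring
  have key : IsPositiveSubsolution d a T (Real.exp (-a) * M) (Real.exp (-a) * N) w
      (fun s y => Real.exp (-s) * |R s y|) := by
    refine ⟨?_, ?_, ?_, fun t ht y => (hderiv t ht y).differentiableAt, ?_, ?_, ?_, ?_, ?_⟩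
    · refine Continuous.mul (by fun_prop) ?_
      exact hv_cont.comp_continuous (f := fun p : ℝ × EuclideanSpace ℝ (Fin d) => (cl p.1, p.2))
        (by fun_prop) fun p => ⟨hcl_mem _, trivial⟩
    · intro t y
      rw [abs_mul, Real.abs_exp]
      exact mul_le_mul (Real.exp_le_exp.2 (neg_le_neg (hcl_mem t).1)) (hM _ (hcl_mem t) y)
        (abs_nonneg _) (Real.exp_nonneg _)
    · intro t ht
      simp only [hw, hcl_a t ht, hcl_a a le_rfl]
    · intro t ht
      rw [hw_of_mem t (Set.Ioo_subset_Icc_self ht)]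
      exact contDiff_const.mul (hv_space t (hsub ht))
    · exact Measurable.mul (by fun_prop) (by simpa using hR_meas.norm)
    · exact fun t ht y => by positivity
    · exact fun t ht y => mul_le_mul (Real.exp_le_exp.2 (neg_le_neg ht.1.le)) (hN t (hsub ht) y)
        (abs_nonneg _) (Real.exp_nonneg _)
    · intro t ht y hpos
      rw [hw_of_mem t (Set.Ioo_subset_Icc_self ht)] at hpos ⊢
      have hv := pos_of_mul_pos_right hpos (Real.exp_nonneg _)
      rw [(hderiv t ht y).deriv, laplacian_const_mul (hv_space t (hsub ht)), ← mul_sub]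
      refine mul_le_mul_of_nonneg_left ?_ (Real.exp_nonneg _)
      have h1 := hpde t (hsub ht) y
      have h2 := mul_nonneg (hG_nonneg t (hsub ht) y) hv.le
      linarith [le_abs_self (R t y)]
  have hmain := key.le_heatOp_add_integral haT x
  have hva : Continuous (v a) := by
    have h1 := (key.continuous_at_time a).const_mul (Real.exp a)
    rw [hw_of_mem a ⟨le_rfl, haT.le⟩] at h1
    simpa [← mul_assoc, ← Real.exp_add] using h1
  have hMa : ∀ y, |v a y| ≤ M := hM a ⟨le_rfl, haT.le.trans hT.2⟩
  have hmono : heatOp d (T - a) (fun y => max (w a y) 0) x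
      ≤ Real.exp (-a) * heatOp d (T - a) (fun y => |v a y|) x := by
    rw [← heatOp_const_mul, heatOp_eq_integral, heatOp_eq_integral]
    refine integral_mono (integrable_comp_heatMeasure (key.continuous_max_at_time a)
      (M := Real.exp (-a) * M) (fun y => ?_) x _)
      ((integrable_comp_heatMeasure hva.abs (M := M)
        (fun y => by rw [abs_abs]; exact hMa y) x _).const_mul _) fun z => ?_
    · rw [abs_of_nonneg (le_max_right _ _)]
      exact key.max_le a y
    · simp only [hw_of_mem a ⟨le_rfl, haT.le⟩]
      refine max_le (mul_le_mul_of_nonneg_left (le_abs_self _) (Real.exp_nonneg _)) (by positivity)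
  simp only [heatOp_const_mul, hw_of_mem T ⟨haT.le, le_rfl⟩] at hmain
  have hfin := mul_le_mul_of_nonneg_left (hmain.trans (add_le_add_left hmono _))
    (Real.exp_nonneg T)
  rw [mul_add, ← mul_assoc, ← Real.exp_add, ← mul_assoc, ← Real.exp_add,
    ← intervalIntegral.integral_const_mul] at hfin
  simpa only [← mul_assoc, ← Real.exp_add, add_neg_cancel, Real.exp_zero, one_mul,
    ← sub_eq_add_neg] using hfin

/-- Maximum-principle comparison: if `v` is bounded, continuous on `[a,b] × ℝ^d`,
`C¹` in time and `C²` in space on `(a,b) × ℝ^d`, and satisfies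
`∂_t v - Δv - v = -G v + R` with `G ≥ 0` measurable and `R` measurable bounded, then
`|v(t,x)| ≤ e^{t-a} ∫ p_{t-a}(x-y)|v(a,y)| dy + ∫_a^t e^{t-s} ∫ p_{t-s}(x-y)|R(s,y)| dy ds`. -/
theorem stmt7 (d : ℕ) (hd : 1 ≤ d) (a b : ℝ) (hab : a < b)
    (v G R : ℝ → EuclideanSpace ℝ (Fin d) → ℝ)
    (hv_cont : ContinuousOn (fun p : ℝ × EuclideanSpace ℝ (Fin d) => v p.1 p.2)
      (Set.Icc a b ×ˢ Set.univ))
    (hv_bdd : ∃ M : ℝ, ∀ t ∈ Set.Icc a b, ∀ x, |v t x| ≤ M)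
    (hv_time : ∀ t ∈ Set.Ioo a b, ∀ x, ContDiffAt ℝ 1 (fun s => v s x) t)
    (hv_space : ∀ t ∈ Set.Ioo a b, ∀ x, ContDiffAt ℝ 2 (fun y => v t y) x)
    (hG_meas : Measurable (fun p : ℝ × EuclideanSpace ℝ (Fin d) => G p.1 p.2))
    (hR_meas : Measurable (fun p : ℝ × EuclideanSpace ℝ (Fin d) => R p.1 p.2))
    (hG_nonneg : ∀ t ∈ Set.Ioo a b, ∀ x, 0 ≤ G t x)
    (hR_bdd : ∃ M : ℝ, ∀ t ∈ Set.Ioo a b, ∀ x, |R t x| ≤ M)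
    (hpde : ∀ t ∈ Set.Ioo a b, ∀ x,
      deriv (fun s => v s x) t - laplacian (v t) x - v t x = -(G t x) * v t x + R t x) :
    ∀ t ∈ Set.Icc a b, ∀ x,
      |v t x| ≤ Real.exp (t - a) * heatOp d (t - a) (fun y => |v a y|) x +
        ∫ s in a..t, Real.exp (t - s) * heatOp d (t - s) (fun y => |R s y|) x := by
  intro t ht x
  rcases ht.1.eq_or_lt with rfl | hat
  · simp [heatOp]
  have hT : t ∈ Set.Ioc a b := ⟨hat, ht.2⟩
  have hdiff : ∀ t ∈ Set.Ioo a b, ∀ x, DifferentiableAt ℝ (fun s => v s x) t :=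
    fun t ht x => (hv_time t ht x).differentiableAt (by norm_num)
  have hC2 : ∀ t ∈ Set.Ioo a b, ContDiff ℝ 2 (v t) :=
    fun t ht => contDiff_iff_contDiffAt.2 (hv_space t ht)
  refine abs_le'.2 ⟨le_heatOp_add_integral_of_pde hv_cont hv_bdd hdiff hC2 hR_meas hG_nonneg
    hR_bdd hpde hT x, ?_⟩
  have hneg := le_heatOp_add_integral_of_pde (v := fun s y => -v s y) (R := fun s y => -R s y)
    hv_cont.neg (by simpa using hv_bdd) (fun t ht x => (hdiff t ht x).neg)
    (fun t ht => (hC2 t ht).neg) hR_meas.neg hG_nonneg (by simpa using hR_bdd)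
    (fun t ht x => ?_) hT x
  · simpa only [abs_neg] using hneg
  · have h1 := laplacian_const_mul (hC2 t ht) (-1) x
    simp only [neg_one_mul] at h1
    rw [h1, deriv.fun_neg]
    linarith [hpde t ht x]
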